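/- arXiv:1901.02135 — 2 statements merged into one kernel-verified Lean document; each statement's English description precedes it below -/
import Mathlib

section
/- Let (X,d) be a compact metric space, φ a continuous flow on X without fixed points, and μ an ergodic φ-invariant Borel probability measure. Then h_μ(φ₁) ≤ h_top^B(φ, G_μ(φ)), i.e. the measure-theoretic entropy of the time-one map is a lower bound for the Bowen entropy of the set of generic points of μ. -/
open MeasureTheory Filter Set Topology
open scoped ENNReal NNReal

namespace FlowEntropy

variable {X : Type*}

/-- A continuous flow on `X`. -/
structure IsFlow [TopologicalSpace X] (φ : ℝ → X → X) : Prop where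
  cont : Continuous fun p : ℝ × X => φ p.1 p.2
  map_zero : ∀ x, φ 0 x = x
  map_add : ∀ s t : ℝ, ∀ x, φ (s + t) x = φ s (φ t x)

/-- The flow has no fixed points. -/
def FixedPointFree (φ : ℝ → X → X) : Prop :=
  ∀ x : X, ∃ t : ℝ, φ t x ≠ x

/-- The measure `μ` is invariant under every time-`t` map of the flow. -/
def FlowInvariant [MeasurableSpace X] (φ : ℝ → X → X) (μ : Measure X) : Prop :=
  ∀ t : ℝ, MeasurePreserving (φ t) μ μ

/-- The measure `μ` is invariant and ergodic for the flow: every Borel set invariant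
under all time-`t` maps has measure `0` or `1`. -/
def FlowErgodic [MeasurableSpace X] (φ : ℝ → X → X) (μ : Measure X) : Prop :=
  FlowInvariant φ μ ∧
    ∀ B : Set X, MeasurableSet B → (∀ t : ℝ, φ t ⁻¹' B = B) → μ B = 0 ∨ μ B = 1

/-- `α` is a reparametrization on the closed interval `I` (containing the origin):
a continuous map that is a homeomorphism onto its image (equivalently, continuous and
injective on the compact interval), fixing the origin. -/
def IsReparOn (α : ℝ → ℝ) (I : Set ℝ) : Prop :=
  ContinuousOn α I ∧ Set.InjOn α I ∧ α 0 = 0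

/-- The reparametrization ball `B(x, t, ε, φ)`. -/
def reparBall [PseudoMetricSpace X] (φ : ℝ → X → X) (x : X) (t ε : ℝ) : Set X :=
  {y : X | ∃ α : ℝ → ℝ, IsReparOn α (Set.Icc 0 t) ∧
      ∀ s ∈ Set.Icc (0 : ℝ) t, dist (φ (α s) x) (φ s y) < ε}

/-- `M^s_{N,ε}(φ, Z)`: infimum of `Σ_i exp (-s t_i)` over countable families of
reparametrization balls `B(x_i, t_i, ε, φ)` with `t_i ≥ N` covering `Z`. -/
noncomputable def coverM [PseudoMetricSpace X] (φ : ℝ → X → X) (Z : Set X) (s : ℝ) (N : ℕ)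
    (ε : ℝ) : ℝ≥0∞ :=
  ⨅ (F : Set (X × ℝ)) (_ : F.Countable) (_ : ∀ p ∈ F, (N : ℝ) ≤ p.2)
    (_ : Z ⊆ ⋃ p ∈ F, reparBall φ p.1 p.2 ε),
    ∑' p : F, ENNReal.ofReal (Real.exp (-s * (p : X × ℝ).2))

/-- `M^s_ε(φ, Z) = lim_{N → ∞} M^s_{N,ε}(φ, Z)` (an increasing limit). -/
noncomputable def coverMeps [PseudoMetricSpace X] (φ : ℝ → X → X) (Z : Set X) (s ε : ℝ) :
    ℝ≥0∞ :=
  ⨆ N : ℕ, coverM φ Z s N ε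

/-- `M^s(φ, Z) = lim_{ε → 0} M^s_ε(φ, Z)` (an increasing limit as `ε` decreases). -/
noncomputable def coverMlim [PseudoMetricSpace X] (φ : ℝ → X → X) (Z : Set X) (s : ℝ) :
    ℝ≥0∞ :=
  ⨆ (ε : ℝ) (_ : 0 < ε), coverMeps φ Z s ε

/-- The Bowen entropy `h_top^B(φ, Z)`: the critical value where `M^s(φ,Z)` jumps
from `∞` to `0` (as an extended nonnegative real; `⊤` if no finite critical value). -/
noncomputable def bowenEntropy [PseudoMetricSpace X] (φ : ℝ → X → X) (Z : Set X) : ℝ≥0∞ :=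
  ⨅ (s : ℝ) (_ : 0 ≤ s) (_ : coverMlim φ Z s = 0), ENNReal.ofReal s

/-- Static entropy of a finite measurable partition, encoded as a map into a finite type. -/
noncomputable def partEnt [MeasurableSpace X] (μ : Measure X) {ι : Type*} [Fintype ι]
    (P : X → ι) : ℝ :=
  ∑ i : ι, Real.negMulLog ((μ (P ⁻¹' {i})).toReal)

/-- The measure-theoretic (Kolmogorov–Sinai) entropy of a map `T` with respect to `μ`:
the supremum over finite measurable partitions of the asymptotic entropy per unit time of
the dynamical refinements. -/
noncomputable def kolSinai [MeasurableSpace X] (μ : Measure X) (T : X → X) : ℝ≥0∞ :=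
  ⨆ (k : ℕ) (P : X → Fin k) (_ : Measurable P),
    Filter.limsup (fun n : ℕ =>
      ENNReal.ofReal (partEnt μ (fun x => fun j : Fin n => P (T^[(j : ℕ)] x)) / n))
      Filter.atTop

/-- `-log a` as a member of `ℝ≥0∞`, for `a ∈ [0,1]` (with `-log 0 = ∞`). -/
noncomputable def negLogNN (a : ℝ≥0∞) : ℝ≥0∞ :=
  if a = 0 then ⊤ else ENNReal.ofReal (-Real.log a.toReal)

/-- `-(1/t) log μ(B(x,t,ε,φ))`, as a member of `ℝ≥0∞`. -/
noncomputable def localRate [PseudoMetricSpace X] [MeasurableSpace X] (μ : Measure X)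
    (φ : ℝ → X → X) (x : X) (ε t : ℝ) : ℝ≥0∞ :=
  negLogNN (μ (reparBall φ x t ε)) / ENNReal.ofReal t

/-- The lower local entropy `underline h_μ(φ, x) = lim_{ε→0} liminf_{t→∞}
  -(1/t) log μ(B(x,t,ε,φ))` (the limit in `ε` is an increasing limit, hence a supremum). -/
noncomputable def lowerLocalEnt [PseudoMetricSpace X] [MeasurableSpace X] (μ : Measure X)
    (φ : ℝ → X → X) (x : X) : ℝ≥0∞ :=
  ⨆ (ε : ℝ) (_ : 0 < ε), Filter.liminf (fun t : ℝ => localRate μ φ x ε t) Filter.atTop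

/-- The upper local entropy `overline h_μ(φ, x) = lim_{ε→0} limsup_{t→∞}
  -(1/t) log μ(B(x,t,ε,φ))`. -/
noncomputable def upperLocalEnt [PseudoMetricSpace X] [MeasurableSpace X] (μ : Measure X)
    (φ : ℝ → X → X) (x : X) : ℝ≥0∞ :=
  ⨆ (ε : ℝ) (_ : 0 < ε), Filter.limsup (fun t : ℝ => localRate μ φ x ε t) Filter.atTop

/-- The set `G_μ(φ)` of generic points of `μ` for the flow `φ`. -/
def genericPts [TopologicalSpace X] [MeasurableSpace X] (φ : ℝ → X → X) (μ : Measure X) :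
    Set X :=
  {x : X | ∀ f : C(X, ℝ),
    Filter.Tendsto (fun t : ℝ => (1 / t) * ∫ τ in (0 : ℝ)..t, f (φ τ x))
      Filter.atTop (nhds (∫ y, f y ∂μ))}


/-- The running maximum `max_{k ≤ n} S_k g` of Birkhoff sums, computed recursively. -/
noncomputable def birkhoffMax (T : X → X) (g : X → ℝ) : ℕ → X → ℝ
  | 0, _ => 0
  | n + 1, x => max 0 (g x + birkhoffMax T g n (T x))

lemma birkhoffMax_nonneg (T : X → X) (g : X → ℝ) (n : ℕ) (x : X) : 0 ≤ birkhoffMax T g n x := by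
  cases n with
  | zero => exact le_rfl
  | succ n => exact le_max_left _ _

lemma birkhoffMax_le_succ (T : X → X) (g : X → ℝ) (n : ℕ) (x : X) :
    birkhoffMax T g n x ≤ birkhoffMax T g (n + 1) x := by
  induction n generalizing x with
  | zero => exact birkhoffMax_nonneg _ _ _ _
  | succ n ih => exact max_le_max le_rfl (by linarith [ih (T x)])

lemma birkhoffSum_le_birkhoffMax (T : X → X) (g : X → ℝ) (n : ℕ) (x : X) :
    birkhoffSum T g n x ≤ birkhoffMax T g n x := by
  induction n generalizing x with
  | zero => simp [birkhoffMax]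
  | succ n ih =>
    rw [birkhoffSum_succ']
    exact le_max_of_le_right (by linarith [ih (T x)])

lemma measurable_birkhoffMax [MeasurableSpace X] {T : X → X} {g : X → ℝ} (hT : Measurable T)
    (hg : Measurable g) (n : ℕ) : Measurable (birkhoffMax T g n) := by
  induction n with
  | zero => exact measurable_const
  | succ n ih => exact measurable_const.max (hg.add (ih.comp hT))

lemma integrable_birkhoffMax [MeasurableSpace X] {μ : Measure X} {T : X → X} {g : X → ℝ}
    (hT : MeasurePreserving T μ μ) (hg : Integrable g μ) (n : ℕ) :
    Integrable (birkhoffMax T g n) μ := by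
  induction n with
  | zero => exact integrable_zero _ _ _
  | succ n ih =>
    exact (integrable_zero _ _ _).sup (hg.add (hT.integrable_comp_of_integrable ih))

/-- A form of the maximal ergodic theorem. -/
lemma integral_nonneg_of_birkhoffSum_pos [MeasurableSpace X] {μ : Measure X} {T : X → X}
    {g : X → ℝ} (hT : MeasurePreserving T μ μ) (hgm : Measurable g) (hg : Integrable g μ)
    (h : ∀ᵐ x ∂μ, ∃ n, 0 < birkhoffSum T g n x) : 0 ≤ ∫ x, g x ∂μ := by
  let E : ℕ → Set X := fun n => {x | 0 < birkhoffMax T g n x}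
  have hE : ∀ n, MeasurableSet (E n) := fun n =>
    measurableSet_lt measurable_const (measurable_birkhoffMax hT.measurable hgm n)
  have hlim : Tendsto (fun n => ∫ x, (E n).indicator g x ∂μ) atTop (𝓝 (∫ x, g x ∂μ)) := by
    refine tendsto_integral_of_dominated_convergence (fun x => |g x|)
      (fun n => (hgm.indicator (hE n)).aestronglyMeasurable) hg.abs
      (fun n => ae_of_all _ fun x => ?_) ?_
    · by_cases hx : x ∈ E n <;> simp [hx]
    · filter_upwards [h] with x ⟨n, hn⟩
      refine tendsto_const_nhds.congr' ?_
      filter_upwards [eventually_ge_atTop n] with m hm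
      have hmem : x ∈ E m :=
        (hn.trans_le (birkhoffSum_le_birkhoffMax T g n x)).trans_le
          (monotone_nat_of_le_succ (f := fun k => birkhoffMax T g k x)
            (fun k => birkhoffMax_le_succ T g k x) hm)
      simp [hmem]
  refine ge_of_tendsto hlim ?_
  filter_upwards [eventually_ge_atTop 1] with m hm
  obtain ⟨n, rfl⟩ := Nat.exists_eq_add_of_le' hm
  have hi := integrable_birkhoffMax hT hg
  have hi' : Integrable (fun x => birkhoffMax T g n (T x)) μ :=
    hT.integrable_comp_of_integrable (hi n)
  have hcomp : ∫ x, birkhoffMax T g n (T x) ∂μ = ∫ x, birkhoffMax T g n x ∂μ := by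
    conv_rhs => rw [← hT.map_eq]
    rw [integral_map hT.measurable.aemeasurable
      (measurable_birkhoffMax hT.measurable hgm n).aestronglyMeasurable]
  have hpt : ∀ x, birkhoffMax T g (n + 1) x - birkhoffMax T g n (T x)
      ≤ (E (n + 1)).indicator g x := by
    intro x
    by_cases hx : x ∈ E (n + 1)
    · have hx' : 0 < max 0 (g x + birkhoffMax T g n (T x)) := hx
      have : 0 < g x + birkhoffMax T g n (T x) := by simpa using hx'
      rw [indicator_of_mem hx]
      simp only [birkhoffMax, max_eq_right this.le]
      linarith
    · have hx' : birkhoffMax T g (n + 1) x ≤ 0 := not_lt.1 hx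
      rw [indicator_of_notMem hx]
      linarith [birkhoffMax_nonneg T g n (T x)]
  calc 0 ≤ ∫ x, birkhoffMax T g (n + 1) x ∂μ - ∫ x, birkhoffMax T g n x ∂μ :=
        sub_nonneg.2 (integral_mono (hi n) (hi (n + 1)) (birkhoffMax_le_succ T g n))
    _ = ∫ x, (birkhoffMax T g (n + 1) x - birkhoffMax T g n (T x)) ∂μ := by
        rw [integral_sub (hi _) hi', hcomp]
    _ ≤ _ := integral_mono ((hi _).sub hi')
        (hg.indicator (hE _)) hpt

lemma IsFlow.iterate_one [TopologicalSpace X] {φ : ℝ → X → X} (hφ : IsFlow φ) (n : ℕ) (x : X) :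
    (φ 1)^[n] x = φ n x := by
  induction n with
  | zero => simp [hφ.map_zero]
  | succ n ih => rw [Function.iterate_succ_apply', ih, ← hφ.map_add, Nat.cast_succ, add_comm]

lemma IsFlow.continuous_orbit [TopologicalSpace X] {φ : ℝ → X → X} (hφ : IsFlow φ) (x : X) :
    Continuous fun t => φ t x :=
  hφ.cont.comp (Continuous.prodMk_left x)

lemma IsFlow.continuous_map [TopologicalSpace X] {φ : ℝ → X → X} (hφ : IsFlow φ) (t : ℝ) :
    Continuous (φ t) :=
  hφ.cont.comp (Continuous.prodMk_right t)

section Generic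

variable [MetricSpace X] {φ : ℝ → X → X}

lemma IsFlow.intervalIntegrable (hφ : IsFlow φ) (f : C(X, ℝ)) (x : X) (a b : ℝ) :
    IntervalIntegrable (fun τ => f (φ τ x)) volume a b :=
  (f.continuous.comp (hφ.continuous_orbit x)).intervalIntegrable a b

lemma IsFlow.continuous_intervalIntegral (hφ : IsFlow φ) (f : C(X, ℝ)) (t : ℝ) :
    Continuous fun x => ∫ τ in (0 : ℝ)..t, f (φ τ x) := by
  refine intervalIntegral.continuous_parametric_intervalIntegral_of_continuous' ?_ 0 t
  exact f.continuous.comp (hφ.cont.comp continuous_swap)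

lemma IsFlow.intervalIntegral_shift (hφ : IsFlow φ) (f : C(X, ℝ)) (s a b : ℝ) (x : X) :
    ∫ τ in a..b, f (φ τ (φ s x)) = ∫ τ in (a + s)..(b + s), f (φ τ x) := by
  simp_rw [← hφ.map_add]
  exact intervalIntegral.integral_comp_add_right (fun τ => f (φ τ x)) s

lemma IsFlow.birkhoffSum_eq (hφ : IsFlow φ) (f : C(X, ℝ)) (n : ℕ) (x : X) :
    birkhoffSum (φ 1) (fun y => ∫ τ in (0 : ℝ)..1, f (φ τ y)) n x
      = ∫ τ in (0 : ℝ)..n, f (φ τ x) := by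
  have h := intervalIntegral.sum_integral_adjacent_intervals (μ := volume)
    (f := fun τ => f (φ τ x)) (a := fun k : ℕ => (k : ℝ)) (n := n)
    (fun k _ => hφ.intervalIntegrable f x _ _)
  rw [Nat.cast_zero] at h
  rw [← h, birkhoffSum]
  refine Finset.sum_congr rfl fun k _ => ?_
  rw [hφ.iterate_one, hφ.intervalIntegral_shift, zero_add, Nat.cast_succ, add_comm]

/-- The points along whose orbits the integer-time averages of `f` have upper limit above `c`. -/
def largeAverage (φ : ℝ → X → X) (f : C(X, ℝ)) (c : ℝ) : Set X :=
  {x | ∃ k : ℕ, ∃ᶠ n : ℕ in atTop, (c + 1 / (k + 1)) * n < ∫ τ in (0 : ℝ)..n, f (φ τ x)}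

lemma IsFlow.measurableSet_largeAverage [MeasurableSpace X] [BorelSpace X] (hφ : IsFlow φ)
    (f : C(X, ℝ)) (c : ℝ) :
    MeasurableSet (largeAverage φ f c) := by
  have : largeAverage φ f c = ⋃ k : ℕ, ⋂ N : ℕ, ⋃ n : ℕ, ⋃ _ : N ≤ n,
      {x | (c + 1 / (k + 1)) * n < ∫ τ in (0 : ℝ)..n, f (φ τ x)} := by
    ext x
    simp [largeAverage, frequently_atTop]
  rw [this]
  exact .iUnion fun k => .iInter fun N => .iUnion fun n => .iUnion fun _ =>
    measurableSet_lt measurable_const (hφ.continuous_intervalIntegral f n).measurable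

variable [CompactSpace X]

lemma abs_orbit_integral_le (f : C(X, ℝ)) (x : X) (a b : ℝ) :
    |∫ τ in a..b, f (φ τ x)| ≤ ‖f‖ * |b - a| :=
  intervalIntegral.norm_integral_le_of_norm_le_const fun _ _ => f.norm_coe_le_norm _

lemma IsFlow.abs_integral_shift_sub_le (hφ : IsFlow φ) (f : C(X, ℝ)) (s t : ℝ) (x : X) :
    |(∫ τ in (0 : ℝ)..t, f (φ τ (φ s x))) - ∫ τ in (0 : ℝ)..t, f (φ τ x)| ≤ 2 * ‖f‖ * |s| := by
  have hi := hφ.intervalIntegrable f x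
  rw [hφ.intervalIntegral_shift, zero_add,
    ← intervalIntegral.integral_add_adjacent_intervals (hi s 0) (hi 0 (t + s)),
    ← intervalIntegral.integral_add_adjacent_intervals (hi 0 t) (hi t (t + s))]
  have h1 := abs_orbit_integral_le (φ := φ) f x s 0
  have h2 := abs_orbit_integral_le (φ := φ) f x t (t + s)
  rw [zero_sub, abs_neg] at h1
  rw [add_sub_cancel_left] at h2
  rw [abs_le] at *
  constructor <;> linarith

lemma IsFlow.map_mem_largeAverage (hφ : IsFlow φ) (f : C(X, ℝ)) (c s : ℝ) {x : X}
    (hx : x ∈ largeAverage φ f c) : φ s x ∈ largeAverage φ f c := by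
  obtain ⟨k, hk⟩ := hx
  refine ⟨k + 1, ?_⟩
  have hgap : (0 : ℝ) < 1 / (k + 1) - 1 / ((k + 1 : ℕ) + 1) := by
    rw [sub_pos]
    apply one_div_lt_one_div_of_lt <;> push_cast <;> linarith [k.cast_nonneg (α := ℝ)]
  have hlarge : ∀ᶠ n : ℕ in atTop,
      2 * ‖f‖ * |s| < (1 / (k + 1) - 1 / ((k + 1 : ℕ) + 1)) * (n : ℝ) :=
    (tendsto_natCast_atTop_atTop.const_mul_atTop hgap).eventually_gt_atTop _
  refine (hk.and_eventually hlarge).mono fun n ⟨h1, h2⟩ => ?_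
  have h3 := (abs_le.1 (hφ.abs_integral_shift_sub_le f s n x)).1
  linarith

variable [MeasurableSpace X] [BorelSpace X] {μ : Measure X} [IsProbabilityMeasure μ]

lemma IsFlow.integral_unitAverage (hφ : IsFlow φ) (hμ : FlowInvariant φ μ) (f : C(X, ℝ)) :
    ∫ x, (∫ τ in (0 : ℝ)..1, f (φ τ x)) ∂μ = ∫ x, f x ∂μ := by
  have hconst : ∀ τ, ∫ x, f (φ τ x) ∂μ = ∫ x, f x ∂μ := by
    intro τ
    conv_rhs => rw [← (hμ τ).map_eq]
    rw [integral_map (hμ τ).measurable.aemeasurable f.continuous.aestronglyMeasurable]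
  simp_rw [intervalIntegral.integral_of_le zero_le_one]
  rw [integral_integral_swap]
  · simp [hconst]
  · refine Integrable.of_bound (C := ‖f‖) ?_ (ae_of_all _ fun p => f.norm_coe_le_norm _)
    exact (f.continuous.comp (hφ.cont.comp continuous_swap)).aestronglyMeasurable

lemma IsFlow.measure_largeAverage (hφ : IsFlow φ) (herg : FlowErgodic φ μ) (f : C(X, ℝ)) {c : ℝ}
    (hc : ∫ x, f x ∂μ < c) : μ (largeAverage φ f c) = 0 := by
  refine (herg.2 _ (hφ.measurableSet_largeAverage f c) fun t => ?_).resolve_right fun h1 => ?_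
  · refine Subset.antisymm (fun x hx => ?_) fun x hx => hφ.map_mem_largeAverage f c t hx
    have := hφ.map_mem_largeAverage f c (-t) hx
    rwa [← hφ.map_add, neg_add_cancel, hφ.map_zero] at this
  · set F : X → ℝ := fun y => ∫ τ in (0 : ℝ)..1, f (φ τ y) with hF
    have hFc : Continuous F := hφ.continuous_intervalIntegral f 1
    have hFi : Integrable F μ := by
      refine Integrable.of_bound hFc.aestronglyMeasurable (C := ‖f‖) (ae_of_all _ fun x => ?_)
      simpa using abs_orbit_integral_le (φ := φ) f x 0 1
    have hae : ∀ᵐ x ∂μ, x ∈ largeAverage φ f c := by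
      rw [← prob_compl_eq_zero_iff (hφ.measurableSet_largeAverage f c)] at h1
      exact measure_eq_zero_iff_ae_notMem.1 h1 |>.mono fun x hx => not_not.1 hx
    have hpos := integral_nonneg_of_birkhoffSum_pos (g := fun x => F x - c) (herg.1 1)
      (hFc.measurable.sub_const c) (hFi.sub (integrable_const c)) (hae.mono fun x ⟨k, hk⟩ => by
        obtain ⟨n, hn⟩ := hk.exists
        refine ⟨n, ?_⟩
        have heq : birkhoffSum (φ 1) (fun x => F x - c) n x
            = birkhoffSum (φ 1) F n x - n * c := by
          simp [birkhoffSum, Finset.sum_sub_distrib]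
        rw [heq, hφ.birkhoffSum_eq]
        have : (0 : ℝ) ≤ 1 / (k + 1) * n := by positivity
        linarith)
    rw [integral_sub hFi (integrable_const c), hF, hφ.integral_unitAverage herg.1] at hpos
    simp at hpos
    linarith

lemma IsFlow.ae_eventually_integral_le (hφ : IsFlow φ) (herg : FlowErgodic φ μ) (f : C(X, ℝ)) :
    ∀ᵐ x ∂μ, ∀ ε > 0, ∀ᶠ t : ℝ in atTop,
      ∫ τ in (0 : ℝ)..t, f (φ τ x) ≤ (∫ y, f y ∂μ + ε) * t := by
  have hae : ∀ᵐ x ∂μ, ∀ j : ℕ, x ∉ largeAverage φ f (∫ y, f y ∂μ + 1 / (j + 1)) :=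
    ae_all_iff.2 fun j => measure_eq_zero_iff_ae_notMem.1
      (hφ.measure_largeAverage herg f (lt_add_of_pos_right _ Nat.one_div_pos_of_nat))
  filter_upwards [hae] with x hx ε hε
  obtain ⟨j, hj⟩ := exists_nat_one_div_lt (show 0 < ε / 3 by positivity)
  have hn : ∀ᶠ n : ℕ in atTop, ∫ τ in (0 : ℝ)..n, f (φ τ x)
      ≤ (∫ y, f y ∂μ + 1 / (j + 1) + 1 / (j + 1)) * n := by
    have := hx j
    simp only [largeAverage, mem_ofPred_eq, not_exists, not_frequently, not_lt] at this
    exact this j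
  set m := ∫ y, f y ∂μ
  set m' := m + 1 / ((j : ℝ) + 1) + 1 / (j + 1)
  have hbig : ∀ᶠ t : ℝ in atTop, ‖f‖ + |m'| < ε / 3 * t :=
    (tendsto_id.const_mul_atTop (show 0 < ε / 3 by positivity)).eventually_gt_atTop _
  filter_upwards [(tendsto_nat_floor_atTop (α := ℝ)).eventually hn, hbig,
    eventually_ge_atTop 0] with t h1 h2 h3
  have hle := Nat.floor_le h3
  have hlt := Nat.lt_floor_add_one t
  have h4 := abs_orbit_integral_le (φ := φ) f x ⌊t⌋₊ t
  rw [← intervalIntegral.integral_add_adjacent_intervals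
    (hφ.intervalIntegrable f x 0 ⌊t⌋₊) (hφ.intervalIntegrable f x ⌊t⌋₊ t)]
  rw [abs_of_nonneg (sub_nonneg.2 hle)] at h4
  have h5 : ‖f‖ * (t - ⌊t⌋₊) ≤ ‖f‖ := mul_le_of_le_one_right (norm_nonneg _) (by linarith)
  have h6 : m' * ⌊t⌋₊ ≤ m' * t + |m'| := by
    have : -m' * (t - ⌊t⌋₊) ≤ |m'| * 1 :=
      mul_le_mul (neg_le_abs m') (by linarith) (by linarith) (abs_nonneg _)
    linarith
  have h7 : m' * t ≤ (m + 2 * (ε / 3)) * t :=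
    mul_le_mul_of_nonneg_right (by simp only [m']; linarith) h3
  linarith [le_abs_self (∫ τ in (⌊t⌋₊ : ℝ)..t, f (φ τ x))]

lemma IsFlow.ae_tendsto_average (hφ : IsFlow φ) (herg : FlowErgodic φ μ) (f : C(X, ℝ)) :
    ∀ᵐ x ∂μ, Tendsto (fun t : ℝ => (1 / t) * ∫ τ in (0 : ℝ)..t, f (φ τ x)) atTop
      (𝓝 (∫ y, f y ∂μ)) := by
  filter_upwards [hφ.ae_eventually_integral_le herg f, hφ.ae_eventually_integral_le herg (-f)]
    with x h1 h2
  refine Metric.tendsto_nhds.2 fun ε hε => ?_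
  filter_upwards [h1 (ε / 2) (by positivity), h2 (ε / 2) (by positivity), eventually_gt_atTop 0]
    with t ht1 ht2 ht
  simp only [ContinuousMap.coe_neg, Pi.neg_apply, intervalIntegral.integral_neg,
    integral_neg] at ht2
  have h3 : 1 / t * ∫ τ in (0 : ℝ)..t, f (φ τ x) ≤ ∫ y, f y ∂μ + ε / 2 := by
    rw [one_div_mul_eq_div, div_le_iff₀ ht]; exact ht1
  have h4 : ∫ y, f y ∂μ - ε / 2 ≤ 1 / t * ∫ τ in (0 : ℝ)..t, f (φ τ x) := by
    rw [one_div_mul_eq_div, le_div_iff₀ ht]; linarith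
  rw [Real.dist_eq, abs_lt]
  constructor <;> linarith

/-- Almost every point of an ergodic measure is generic. -/
lemma IsFlow.ae_mem_genericPts (hφ : IsFlow φ) (herg : FlowErgodic φ μ) :
    ∀ᵐ x ∂μ, x ∈ genericPts φ μ := by
  have hae := ae_all_iff.2 fun n : ℕ =>
    hφ.ae_tendsto_average herg (TopologicalSpace.denseSeq C(X, ℝ) n)
  filter_upwards [hae] with x hx f
  refine Metric.tendsto_nhds.2 fun ε hε => ?_
  obtain ⟨n, hn⟩ := (TopologicalSpace.denseRange_denseSeq C(X, ℝ)).exists_dist_lt f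
    (show 0 < ε / 3 by positivity)
  set g := TopologicalSpace.denseSeq C(X, ℝ) n
  rw [dist_eq_norm] at hn
  filter_upwards [Metric.tendsto_nhds.1 (hx n) (ε / 3) (by positivity), eventually_gt_atTop 0]
    with t ht ht0
  have h1 : |(1 / t * ∫ τ in (0 : ℝ)..t, f (φ τ x)) - 1 / t * ∫ τ in (0 : ℝ)..t, g (φ τ x)|
      < ε / 3 := by
    rw [← mul_sub, ← intervalIntegral.integral_sub (hφ.intervalIntegrable f x 0 t)
      (hφ.intervalIntegrable g x 0 t), abs_mul, abs_of_pos (one_div_pos.2 ht0),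
      one_div_mul_eq_div, div_lt_iff₀ ht0]
    have := abs_orbit_integral_le (φ := φ) (f - g) x 0 t
    rw [sub_zero, abs_of_pos ht0] at this
    exact this.trans_lt (mul_lt_mul_of_pos_right hn ht0)
  have h2 : |∫ y, f y ∂μ - ∫ y, g y ∂μ| ≤ ε / 3 := by
    rw [← integral_sub (f.continuous.integrable_of_hasCompactSupport (.of_compactSpace _))
      (g.continuous.integrable_of_hasCompactSupport (.of_compactSpace _))]
    refine (norm_integral_le_of_norm_le_const (μ := μ) (C := ‖f - g‖)
      (ae_of_all _ fun y => (f - g).norm_coe_le_norm y)).trans ?_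
    simpa using hn.le
  rw [Real.dist_eq] at ht ⊢
  rw [abs_lt] at *
  rw [abs_le] at h2
  constructor <;> linarith

end Generic

section Tracking

variable [MetricSpace X] [CompactSpace X] {φ : ℝ → X → X}

lemma IsFlow.exists_forall_map_ne (hφ : IsFlow φ) (hfp : FixedPointFree φ) :
    ∃ τ > 0, ∀ ρ, 0 < ρ → ρ < τ → ∀ z, φ ρ z ≠ z := by
  by_contra! h
  choose ρ hρ0 hρ z hz using fun n : ℕ => h (1 / ((n : ℝ) + 1)) Nat.one_div_pos_of_nat
  obtain ⟨a, -, u, hu, hlim⟩ := isCompact_univ.tendsto_subseq (x := z) fun _ => mem_univ _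
  obtain ⟨t, ht⟩ := hfp a
  refine ht ?_
  set r : ℕ → ℝ := fun n => t - ⌊t / ρ n⌋ * ρ n
  have hr0 : ∀ n, 0 ≤ r n := fun n => sub_nonneg.2 ((le_div_iff₀ (hρ0 n)).1 (Int.floor_le _))
  have hr1 : ∀ n, r n ≤ 1 / ((n : ℝ) + 1) := fun n => by
    have := (div_lt_iff₀ (hρ0 n)).1 (Int.lt_floor_add_one (t / ρ n))
    have := hρ n
    simp only [r]
    linarith
  have hr : Tendsto r atTop (𝓝 0) :=
    squeeze_zero hr0 hr1 tendsto_one_div_add_atTop_nhds_zero_nat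
  have heq : ∀ n, φ (r n) (z n) = φ t (z n) := by
    intro n
    have hper : Function.Periodic (fun s => φ s (z n)) (ρ n) := fun s => by
      simp only [hφ.map_add, hz n]
    have := (hper.int_mul ⌊t / ρ n⌋) (r n)
    simpa [r] using this.symm
  have h1 : Tendsto (fun n => φ (r (u n)) (z (u n))) atTop (𝓝 (φ 0 a)) :=
    (hφ.cont.tendsto (0, a)).comp ((hr.comp hu.tendsto_atTop).prodMk_nhds hlim)
  have h2 : Tendsto (fun n => φ t (z (u n))) atTop (𝓝 (φ t a)) :=
    ((hφ.continuous_map t).tendsto a).comp hlim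
  simp only [heq] at h1
  rw [tendsto_nhds_unique h2 h1, hφ.map_zero]

lemma IsFlow.uniformContinuousOn (hφ : IsFlow φ) (a b : ℝ) {η : ℝ} (hη : 0 < η) :
    ∃ δ > 0, ∀ s ∈ Icc a b, ∀ t ∈ Icc a b, ∀ x y, |s - t| < δ → dist x y < δ →
      dist (φ s x) (φ t y) < η := by
  have huc := (isCompact_Icc.prod (isCompact_univ (X := X))).uniformContinuousOn_of_continuous
    (s := Icc a b ×ˢ univ) hφ.cont.continuousOn
  obtain ⟨δ, hδ, h⟩ := Metric.uniformContinuousOn_iff.1 huc η hη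
  exact ⟨δ, hδ, fun s hs t ht x y hst hxy =>
    h (s, x) ⟨hs, trivial⟩ (t, y) ⟨ht, trivial⟩ (max_lt hst hxy)⟩

lemma IsFlow.exists_dist_time_lt (hφ : IsFlow φ) {η : ℝ} (hη : 0 < η) :
    ∃ δ > 0, ∀ s t, |s - t| < δ → ∀ z, dist (φ s z) (φ t z) < η := by
  obtain ⟨δ, hδ, h⟩ := hφ.uniformContinuousOn (-1) 1 hη
  refine ⟨min δ 1, by positivity, fun s t hst z => ?_⟩
  have h1 := abs_lt.1 (hst.trans_le (min_le_right _ _))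
  have := h (s - t) ⟨by linarith, by linarith⟩ 0 ⟨by norm_num, by norm_num⟩ (φ t z) (φ t z)
    (by simpa using hst.trans_le (min_le_left _ _)) (by simpa using hδ)
  rwa [← hφ.map_add, ← hφ.map_add, sub_add_cancel, zero_add] at this

lemma IsFlow.exists_le_dist_map (hφ : IsFlow φ) {ρ : ℝ} (hρ : ∀ z, φ ρ z ≠ z) :
    ∃ γ > 0, ∀ z, γ ≤ dist (φ ρ z) z := by
  rcases isEmpty_or_nonempty X with hX | hX
  · exact ⟨1, one_pos, fun z => hX.elim z⟩
  · obtain ⟨z, -, hz⟩ := isCompact_univ.exists_isMinOn univ_nonempty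
      ((hφ.continuous_map ρ).dist continuous_id).continuousOn
    exact ⟨_, dist_pos.2 (hρ z), fun w => hz (mem_univ w)⟩

/-- In a flow without short periods, a reparametrization which follows an orbit closely cannot
drift away from the identity on a time interval of bounded length. -/
lemma IsFlow.exists_abs_repar_sub_lt (hφ : IsFlow φ) {ρ : ℝ} (hρ0 : 0 < ρ)
    (hρ : ∀ z, φ ρ z ≠ z) (M : ℝ) :
    ∃ ε > 0, ∀ T ∈ Icc 0 M, ∀ (x y : X) (α : ℝ → ℝ), ContinuousOn α (Icc 0 T) → α 0 = 0 →
      (∀ s ∈ Icc 0 T, dist (φ (α s) x) (φ s y) < ε) → ∀ s ∈ Icc 0 T, |α s - s| < ρ := by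
  obtain ⟨γ, hγ, hγρ⟩ := hφ.exists_le_dist_map hρ
  obtain ⟨δ, hδ, huc⟩ := hφ.uniformContinuousOn 0 M (half_pos hγ)
  refine ⟨min δ (γ / 2), by positivity, fun T hT x y α hα hα0 hd s hs => ?_⟩
  by_contra! hlt
  have hcont : ContinuousOn (fun u => |α u - u|) (Icc 0 s) :=
    ((hα.mono (Icc_subset_Icc_right hs.2)).sub continuousOn_id).abs
  obtain ⟨u, hu, hu'⟩ := intermediate_value_Icc hs.1 hcont
    (show ρ ∈ Icc _ _ from ⟨by simpa [hα0] using hρ0.le, hlt⟩)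
  have huT : u ∈ Icc 0 T := ⟨hu.1, hu.2.trans hs.2⟩
  have huM : u ∈ Icc 0 M := ⟨huT.1, huT.2.trans hT.2⟩
  have hxy : dist y x < δ := by
    have := hd 0 ⟨le_rfl, hT.1⟩
    rw [hα0, hφ.map_zero, hφ.map_zero, dist_comm] at this
    exact this.trans_le (min_le_left _ _)
  have h1 : dist (φ u y) (φ u x) < γ / 2 := huc u huM u huM y x (by simpa using hδ) hxy
  have h2 : dist (φ (α u) x) (φ u x) < γ := by
    have := (hd u huT).trans_le (min_le_right _ _)
    linarith [dist_triangle (φ (α u) x) (φ u y) (φ u x)]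
  refine h2.not_ge ?_
  rcases (abs_eq hρ0.le).1 hu' with h | h
  · have := hγρ (φ u x)
    rwa [← hφ.map_add, ← h, sub_add_cancel] at this
  · have := hγρ (φ (α u) x)
    rwa [← hφ.map_add, show ρ + α u = u by linarith, dist_comm] at this

/-- Points of a reparametrization ball follow one of subexponentially many pseudo-orbits. -/
lemma IsFlow.exists_reparBall_tracked (hφ : IsFlow φ) (hfp : FixedPointFree φ) {η δ : ℝ}
    (hη : 0 < η) (hδ : 0 < δ) :
    ∃ ε > 0, ∀ (x : X) (t : ℝ), 0 ≤ t → ∃ S : Finset (ℕ → X), (S.card : ℝ) ≤ Real.exp (δ * t) ∧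
      ∀ y ∈ reparBall φ x t ε, ∃ c ∈ S, ∀ j : ℕ, (j : ℝ) ≤ t → dist (φ j y) (c j) < η := by
  classical
  obtain ⟨M, hM⟩ := exists_nat_gt (max 1 (Real.log 3 / δ))
  have hM1 : (1 : ℝ) < M := (le_max_left _ _).trans_lt hM
  have hM0 : (0 : ℝ) < M := one_pos.trans hM1
  have hMn : 0 < M := by exact_mod_cast hM0
  have hMδ : Real.log 3 ≤ δ * M := by
    have := (le_max_right _ _).trans_lt hM
    rw [div_lt_iff₀ hδ] at this
    linarith
  obtain ⟨σ, hσ, htime⟩ := hφ.exists_dist_time_lt (half_pos hη)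
  obtain ⟨τ, hτ, hper⟩ := hφ.exists_forall_map_ne hfp
  obtain ⟨ρ, hρ0, hρ⟩ := exists_between (show 0 < min τ (σ / 2) by positivity)
  obtain ⟨ε, hε, htrack⟩ := hφ.exists_abs_repar_sub_lt hρ0
    (hper ρ hρ0 (hρ.trans_le (min_le_left _ _))) M
  have hρσ : 2 * ρ < σ := by linarith [hρ.trans_le (min_le_right _ _)]
  refine ⟨min ε (η / 2), by positivity, fun x t ht => ?_⟩
  set L := ⌊t⌋₊ / M with hL
  let b : (Fin L → Fin 3) → ℕ → ℤ := fun e k =>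
    ∑ i ∈ Finset.range k, if h : i < L then ((e ⟨i, h⟩ : ℕ) : ℤ) - 1 else 0
  refine ⟨Finset.univ.image fun e j => φ (j + ρ * b e (j / M)) x, ?_, ?_⟩
  · have hcard : ((Finset.univ.image fun (e : Fin L → Fin 3) (j : ℕ) =>
        φ (j + ρ * b e (j / M)) x).card : ℝ) ≤ (3 : ℝ) ^ L := by
      have := Finset.card_image_le (s := (Finset.univ : Finset (Fin L → Fin 3)))
        (f := fun e (j : ℕ) => φ (j + ρ * b e (j / M)) x)
      rw [Finset.card_univ, Fintype.card_fun, Fintype.card_fin, Fintype.card_fin] at this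
      exact_mod_cast this
    refine hcard.trans ?_
    rw [← Real.exp_log (show (0 : ℝ) < 3 by norm_num), ← Real.exp_nat_mul]
    refine Real.exp_le_exp.2 ?_
    have h1 : (L : ℝ) * M ≤ t := by
      have : ((L * M : ℕ) : ℝ) ≤ ⌊t⌋₊ := Nat.cast_le.2 (Nat.div_mul_le_self _ _)
      push_cast at this
      exact this.trans (Nat.floor_le ht)
    calc (L : ℝ) * Real.log 3 ≤ L * (δ * M) := by gcongr
      _ = δ * (L * M) := by ring
      _ ≤ δ * t := by gcongr
  · rintro y ⟨α, ⟨hα, -, hα0⟩, hd⟩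
    have hinc : ∀ k : ℕ, ∀ s ∈ Icc (0 : ℝ) M, k * M + s ≤ t →
        |α (k * M + s) - α (k * M) - s| < ρ := by
      intro k s hs hst
      have hk0 : (0 : ℝ) ≤ k * M := by positivity
      have hmaps : ∀ u ∈ Icc (0 : ℝ) s, (k : ℝ) * M + u ∈ Icc 0 t := fun u hu =>
        ⟨add_nonneg hk0 hu.1, by linarith [hu.2]⟩
      refine htrack s hs (φ (α (k * M)) x) (φ (k * M) y)
        (fun u => α (k * M + u) - α (k * M)) ?_ (by simp) (fun u hu => ?_) s ⟨hs.1, le_rfl⟩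
      · exact (hα.comp (by fun_prop) hmaps).sub continuousOn_const
      · rw [← hφ.map_add, ← hφ.map_add, sub_add_cancel, add_comm u]
        exact (hd _ (hmaps u hu)).trans_le (min_le_left _ _)
    let β : ℕ → ℤ := fun k => ⌊(α (k * M) - k * M) / ρ⌋
    have hβ0 : β 0 = 0 := by simp [β, hα0]
    have hLt : ∀ k : ℕ, k ≤ L → (k : ℝ) * M ≤ t := by
      intro k hk
      have : ((k * M : ℕ) : ℝ) ≤ ⌊t⌋₊ :=
        Nat.cast_le.2 ((Nat.mul_le_mul_right M hk).trans (Nat.div_mul_le_self _ _))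
      push_cast at this
      exact this.trans (Nat.floor_le ht)
    have hstep : ∀ i : Fin L, ∃ a : Fin 3, ((a : ℕ) : ℤ) = β (i + 1) - β i + 1 := by
      intro i
      have h1 := hinc i M ⟨hM0.le, le_rfl⟩ (by
        have := hLt (i + 1) i.2
        push_cast at this
        linarith)
      have hcast : (((i : ℕ) + 1 : ℕ) : ℝ) * M = i * M + M := by push_cast; ring
      have h2 : |(α (((i : ℕ) + 1 : ℕ) * M) - ((i : ℕ) + 1 : ℕ) * M) / ρ
          - (α ((i : ℕ) * M) - (i : ℕ) * M) / ρ| < 1 := by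
        rw [hcast, ← sub_div, abs_div, abs_of_pos hρ0, div_lt_one hρ0]
        rw [show α (i * M + M) - (i * M + M) - (α (i * M) - i * M)
          = α (i * M + M) - α (i * M) - M by ring]
        exact h1
      have h3 := Int.floor_le ((α (((i : ℕ) + 1 : ℕ) * M) - ((i : ℕ) + 1 : ℕ) * M) / ρ)
      have h4 := Int.lt_floor_add_one ((α (((i : ℕ) + 1 : ℕ) * M) - ((i : ℕ) + 1 : ℕ) * M) / ρ)
      have h5 := Int.floor_le ((α ((i : ℕ) * M) - (i : ℕ) * M) / ρ)
      have h6 := Int.lt_floor_add_one ((α ((i : ℕ) * M) - (i : ℕ) * M) / ρ)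
      rw [abs_lt] at h2
      have h7 : β (i + 1) - β i < 2 := by
        have : ((β (i + 1) - β i : ℤ) : ℝ) < 2 := by
          simp only [β, Int.cast_sub]
          linarith
        exact_mod_cast this
      have h8 : -2 < β (i + 1) - β i := by
        have : (-2 : ℝ) < ((β (i + 1) - β i : ℤ) : ℝ) := by
          simp only [β, Int.cast_sub]
          linarith
        exact_mod_cast this
      refine ⟨⟨(β (i + 1) - β i + 1).toNat, by omega⟩, ?_⟩
      simp only
      omega
    choose e he using hstep
    have hb : ∀ k ≤ L, b e k = β k := by
      intro k
      induction k with
      | zero => intro _; simp [b, hβ0]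
      | succ k ih =>
        intro hk
        have hk' : k < L := hk
        have h1 : b e (k + 1) = b e k + (((e ⟨k, hk'⟩ : ℕ) : ℤ) - 1) := by
          simp only [b, Finset.sum_range_succ, hk', dite_true]
        rw [h1, ih hk'.le, he]
        simp
    refine ⟨_, Finset.mem_image_of_mem _ (Finset.mem_univ e), fun j hj => ?_⟩
    have hkL : j / M ≤ L := Nat.div_le_div_right (Nat.le_floor hj)
    set k := j / M with hk
    obtain ⟨r, hr, hjr⟩ : ∃ r : ℕ, r < M ∧ j = k * M + r :=
      ⟨j % M, Nat.mod_lt _ hMn, by rw [hk, mul_comm, Nat.div_add_mod]⟩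
    have hjr' : (j : ℝ) = k * M + r := by exact_mod_cast hjr
    have h1 := hinc k r ⟨by positivity, by exact_mod_cast hr.le⟩ (hjr' ▸ hj)
    rw [← hjr'] at h1
    have h2 : ρ * β k ≤ α (k * M) - k * M := by
      have := Int.floor_le ((α (k * M) - k * M) / ρ)
      rw [le_div_iff₀ hρ0] at this
      simp only [β]
      linarith
    have h3 : α (k * M) - k * M < ρ * β k + ρ := by
      have := Int.lt_floor_add_one ((α (k * M) - k * M) / ρ)
      rw [div_lt_iff₀ hρ0] at this
      simp only [β]
      linarith
    have h4 : |α j - (j + ρ * b e k)| < σ := by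
      rw [hb k hkL, abs_lt]
      rw [abs_lt] at h1
      constructor <;> linarith
    have h5 := (hd j ⟨j.cast_nonneg, hj⟩).trans_le (min_le_right _ _)
    have h6 := htime _ _ h4 x
    rw [dist_comm] at h5
    linarith [dist_triangle (φ j y) (φ (α j) x) (φ (j + ρ * b e k) x)]

lemma IsFlow.isOpen_reparBall (hφ : IsFlow φ) (x : X) (t ε : ℝ) : IsOpen (reparBall φ x t ε) := by
  rcases lt_or_ge t 0 with ht | ht
  · convert isOpen_univ
    refine eq_univ_of_forall fun y => ⟨id, ⟨continuousOn_id, injOn_id _, rfl⟩, ?_⟩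
    simp [Icc_eq_empty (not_le.2 ht)]
  refine Metric.isOpen_iff.2 fun y ⟨α, hα, hd⟩ => ?_
  have hcont : ContinuousOn (fun s => dist (φ (α s) x) (φ s y)) (Icc 0 t) :=
    continuous_dist.comp_continuousOn (((hφ.continuous_orbit x).comp_continuousOn hα.1).prodMk
      (hφ.continuous_orbit y).continuousOn)
  obtain ⟨s₀, hs₀, hmax⟩ := isCompact_Icc.exists_isMaxOn (nonempty_Icc.2 ht) hcont
  obtain ⟨δ, hδ, h⟩ := hφ.uniformContinuousOn 0 t (sub_pos.2 (hd s₀ hs₀))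
  refine ⟨δ, hδ, fun z hz => ⟨α, hα, fun s hs => ?_⟩⟩
  have h1 : dist (φ (α s) x) (φ s y) ≤ dist (φ (α s₀) x) (φ s₀ y) := hmax hs
  have h2 := h s hs s hs y z (by simpa using hδ) (by rwa [dist_comm])
  linarith [dist_triangle (φ (α s) x) (φ s y) (φ s z)]

end Tracking

section Coding

lemma partEnt_le_integral [MeasurableSpace X] {μ : Measure X} [IsProbabilityMeasure μ] {ι : Type*}
    [Fintype ι] [MeasurableSpace ι] [MeasurableSingletonClass ι] {P : X → ι} (hP : Measurable P)
    {q : ι → ℝ≥0∞} (hq : ∑ i, q i ≤ 1) {h : X → ℝ} (hh : Integrable h μ)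
    (hle : ∀ x, ENNReal.ofReal (Real.exp (-h x)) ≤ q (P x)) :
    partEnt μ P ≤ ∫ x, h x ∂μ := by
  have hq1 : ∀ i, q i ≠ ⊤ := fun i =>
    ((Finset.single_le_sum (fun _ _ => zero_le) (Finset.mem_univ i)).trans hq).trans_lt
      ENNReal.one_lt_top |>.ne
  have hmeas : ∀ i, MeasurableSet (P ⁻¹' {i}) := fun i => hP (measurableSet_singleton i)
  have hunion : ⋃ i, P ⁻¹' {i} = univ := by ext; simp
  have hdisj : Pairwise (Function.onFun Disjoint fun i => P ⁻¹' {i}) := fun i j hij =>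
    Disjoint.preimage _ (disjoint_singleton.2 hij)
  have hsum : ∑ i, ∫ x in P ⁻¹' {i}, h x ∂μ = ∫ x, h x ∂μ := by
    rw [← integral_iUnion_fintype hmeas hdisj fun i => hh.integrableOn, hunion, setIntegral_univ]
  have hsum1 : ∑ i, (μ (P ⁻¹' {i})).toReal = 1 := by
    rw [← ENNReal.toReal_sum fun i _ => measure_ne_top μ _, ← tsum_fintype (L := .unconditional _),
      ← measure_iUnion hdisj hmeas, hunion, measure_univ, ENNReal.toReal_one]
  have hsumq : ∑ i, (q i).toReal ≤ 1 := by
    rw [← ENNReal.toReal_sum fun i _ => hq1 i]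
    exact ENNReal.toReal_mono ENNReal.one_ne_top hq
  have hterm : ∀ i, Real.negMulLog (μ (P ⁻¹' {i})).toReal
      ≤ ∫ x in P ⁻¹' {i}, h x ∂μ + ((q i).toReal - (μ (P ⁻¹' {i})).toReal) := by
    intro i
    rcases eq_or_ne (μ (P ⁻¹' {i})) 0 with h0 | h0
    · simp [h0, Measure.restrict_eq_zero.2 h0]
    have hp : 0 < (μ (P ⁻¹' {i})).toReal := ENNReal.toReal_pos h0 (measure_ne_top _ _)
    have hpt : ∀ x ∈ P ⁻¹' {i}, Real.exp (-h x) ≤ (q i).toReal := by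
      rintro x rfl
      exact (ENNReal.ofReal_le_iff_le_toReal (hq1 _)).1 (hle x)
    obtain ⟨x₀, hx₀⟩ := nonempty_of_measure_ne_zero h0
    have hqpos : 0 < (q i).toReal := (Real.exp_pos _).trans_le (hpt x₀ hx₀)
    have h1 : (μ (P ⁻¹' {i})).toReal * -Real.log (q i).toReal ≤ ∫ x in P ⁻¹' {i}, h x ∂μ := by
      have : ∫ _ in P ⁻¹' {i}, -Real.log (q i).toReal ∂μ ≤ ∫ x in P ⁻¹' {i}, h x ∂μ := by
        refine setIntegral_mono_on (integrable_const _).integrableOn hh.integrableOn (hmeas i)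
          fun x hx => ?_
        have := (Real.le_log_iff_exp_le hqpos).2 (hpt x hx)
        linarith
      simpa [Measure.real] using this
    have h2 := Real.log_le_sub_one_of_pos (div_pos hqpos hp)
    rw [Real.log_div hqpos.ne' hp.ne'] at h2
    have h3 := mul_le_mul_of_nonneg_left h2 hp.le
    have h4 : (μ (P ⁻¹' {i})).toReal * ((q i).toReal / (μ (P ⁻¹' {i})).toReal - 1)
        = (q i).toReal - (μ (P ⁻¹' {i})).toReal := by field_simp
    rw [h4] at h3
    rw [Real.negMulLog]
    linarith
  calc partEnt μ P ≤ ∑ i, (∫ x in P ⁻¹' {i}, h x ∂μ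
        + ((q i).toReal - (μ (P ⁻¹' {i})).toReal)) := Finset.sum_le_sum fun i _ => hterm i
    _ ≤ ∫ x, h x ∂μ := by
      rw [Finset.sum_add_distrib, Finset.sum_sub_distrib, hsum, hsum1]
      linarith

variable {A : Type*}

/-- The word read by the labelling `P` along the first `n` points of the `T`-orbit of `x`. -/
def word (T : X → X) (P : X → A) (n : ℕ) (x : X) : List A :=
  (List.iterate T x n).map P

lemma length_word (T : X → X) (P : X → A) (n : ℕ) (x : X) : (word T P n x).length = n := by
  simp [word]

lemma word_add (T : X → X) (P : X → A) (m n : ℕ) (x : X) :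
    word T P (m + n) x = word T P m x ++ word T P n (T^[m] x) := by
  simp [word, List.iterate_add]

lemma word_one (T : X → X) (P : X → A) (x : X) : word T P 1 x = [P x] := rfl

lemma word_eq_ofFn (T : X → X) (P : X → A) (n : ℕ) (x : X) :
    word T P n x = List.ofFn fun j : Fin n => P (T^[(j : ℕ)] x) := by
  refine List.ext_getElem (by simp [word]) fun i h1 h2 => ?_
  simp [word]

/-- A subprobability weight on words of length `n` obtained by concatenating code words. -/
lemma exists_word_weight {T : X → X} {P : X → A} {c : List A → ℝ≥0∞} (hc : ∑' u, c u ≤ 1)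
    {g : X → ℝ} (hg : ∀ x, 0 ≤ g x) {K : ℕ} {B : ℝ} (hB : 0 ≤ B)
    (hsingle : ∀ a, ENNReal.ofReal (Real.exp (-B)) ≤ c [a])
    (hblock : ∀ x, ∃ m, 0 < m ∧ m ≤ K ∧
      ENNReal.ofReal (Real.exp (-birkhoffSum T g m x)) ≤ c (word T P m x)) (n : ℕ) :
    ∃ q : List A → ℝ≥0∞, (∑' l : List A, if l.length = n then q l else 0) ≤ 1 ∧
      (∀ l : List A, l.length = n → ENNReal.ofReal (Real.exp (-(n * B))) ≤ q l) ∧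
      ∀ x, ENNReal.ofReal (Real.exp (-(birkhoffSum T g n x + K * B))) ≤ q (word T P n x) := by
  induction n using Nat.strong_induction_on with
  | _ n ih =>
  rcases Nat.eq_zero_or_pos n with rfl | hn
  · refine ⟨fun _ => 1, ?_, fun _ _ => by simp, fun x => ?_⟩
    · rw [tsum_eq_single ([] : List A)]
      · simp
      · intro l hl
        simp [hl]
    · refine ENNReal.ofReal_le_one.2 (Real.exp_le_one_iff.2 ?_)
      have : (0 : ℝ) ≤ K * B := by positivity
      simpa using this
  choose! q hq1 hq2 hq3 using ih
  have hterm : ∀ {m : ℕ} (hm : 0 < m) (hmn : m ≤ n) (l : List A),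
      c (l.take m) * q (n - m) (l.drop m) ≤
        ∑ m ∈ Finset.range n, c (l.take (m + 1)) * q (n - (m + 1)) (l.drop (m + 1)) := by
    intro m hm hmn l
    obtain ⟨m, rfl⟩ := Nat.exists_eq_add_of_le' hm
    exact Finset.single_le_sum (f := fun m => c (l.take (m + 1)) * q (n - (m + 1)) (l.drop (m + 1)))
      (fun _ _ => zero_le) (Finset.mem_range.2 hmn)
  refine ⟨fun l => ∑ m ∈ Finset.range n, c (l.take (m + 1)) * q (n - (m + 1)) (l.drop (m + 1)),
    ?_, ?_, ?_⟩
  · have h1 : ∀ m ∈ Finset.range n, (∑' l : List A, if l.length = n then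
        c (l.take (m + 1)) * q (n - (m + 1)) (l.drop (m + 1)) else 0)
        ≤ ∑' u : List A, if u.length = m + 1 then c u else 0 := by
      intro m hm
      have hmn : m + 1 ≤ n := Finset.mem_range.1 hm
      let G : List A × List A → ℝ≥0∞ := fun p => (if p.1.length = m + 1 then c p.1 else 0) *
        if p.2.length = n - (m + 1) then q (n - (m + 1)) p.2 else 0
      have hinj : Function.Injective fun l : List A => (l.take (m + 1), l.drop (m + 1)) := by
        intro l l' h
        obtain ⟨h1, h2⟩ := Prod.ext_iff.1 h
        dsimp only at h1 h2
        rw [← List.take_append_drop (m + 1) l, ← List.take_append_drop (m + 1) l', h1, h2]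
      calc _ ≤ ∑' l : List A, G (l.take (m + 1), l.drop (m + 1)) := by
            refine ENNReal.tsum_le_tsum fun l => ?_
            split_ifs with hl
            · simp [G, hl, hmn]
            · exact zero_le
        _ ≤ ∑' p, G p := ENNReal.tsum_comp_le_tsum_of_injective hinj G
        _ = ∑' u : List A, (if u.length = m + 1 then c u else 0) * ∑' v : List A,
            if v.length = n - (m + 1) then q (n - (m + 1)) v else 0 := by
            rw [ENNReal.tsum_prod']
            simp_rw [G, ENNReal.tsum_mul_left]
        _ ≤ ∑' u : List A, (if u.length = m + 1 then c u else 0) * 1 := by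
            gcongr
            exact hq1 _ (by omega)
        _ = _ := by simp
    calc _ = ∑' l : List A, ∑ m ∈ Finset.range n, (if l.length = n then
          c (l.take (m + 1)) * q (n - (m + 1)) (l.drop (m + 1)) else 0) := by
          refine tsum_congr fun l => ?_
          split_ifs <;> simp
      _ = ∑ m ∈ Finset.range n, ∑' l : List A, (if l.length = n then
          c (l.take (m + 1)) * q (n - (m + 1)) (l.drop (m + 1)) else 0) :=
          Summable.tsum_finsetSum fun _ _ => ENNReal.summable
      _ ≤ ∑ m ∈ Finset.range n, ∑' u : List A, (if u.length = m + 1 then c u else 0) :=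
          Finset.sum_le_sum h1
      _ = ∑' u : List A, ∑ m ∈ Finset.range n, (if u.length = m + 1 then c u else 0) :=
          (Summable.tsum_finsetSum fun _ _ => ENNReal.summable).symm
      _ ≤ ∑' u, c u := by
          refine ENNReal.tsum_le_tsum fun u => ?_
          rcases Nat.eq_zero_or_pos u.length with h0 | h0
          · simp [h0]
          · obtain ⟨j, hj⟩ := Nat.exists_eq_add_of_le' h0
            simp only [hj, add_left_inj, Finset.sum_ite_eq]
            split_ifs <;> simp
      _ ≤ 1 := hc
  · intro l hl
    refine le_trans ?_ (hterm one_pos hn l)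
    obtain ⟨a, l, rfl⟩ := List.exists_cons_of_length_pos (hl ▸ hn)
    have hl' : l.length = n - 1 := by simp at hl; omega
    have h2 := mul_le_mul' (hsingle a) (hq2 (n - 1) (by omega) l hl')
    rw [← ENNReal.ofReal_mul (Real.exp_pos _).le, ← Real.exp_add] at h2
    change _ ≤ c [a] * q (n - 1) l
    refine le_trans (le_of_eq ?_) h2
    congr 2
    rw [Nat.cast_sub hn]
    push_cast
    ring
  · intro x
    obtain ⟨m, hm, hmK, hmc⟩ := hblock x
    rcases le_or_gt m n with hmn | hmn
    · refine le_trans ?_ (hterm hm hmn _)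
      obtain ⟨r, rfl⟩ := Nat.exists_eq_add_of_le hmn
      rw [word_add, List.take_left' (length_word _ _ _ _), List.drop_left' (length_word _ _ _ _),
        Nat.add_sub_cancel_left, birkhoffSum_add]
      have h2 := mul_le_mul' hmc (hq3 r (by omega) (T^[m] x))
      rw [← ENNReal.ofReal_mul (Real.exp_pos _).le, ← Real.exp_add] at h2
      convert h2 using 3
      ring
    · refine le_trans ?_ (hterm one_pos hn _)
      obtain ⟨r, rfl⟩ := Nat.exists_eq_add_of_le hn
      simp only [Nat.zero_add, Nat.succ_eq_add_one] at *
      rw [word_add, List.take_left' (length_word _ _ _ _), List.drop_left' (length_word _ _ _ _),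
        Nat.add_sub_cancel_left, word_one]
      have h2 := mul_le_mul' (hsingle (P x)) (hq2 r (by omega) (word T P r (T^[1] x))
        (length_word _ _ _ _))
      rw [← ENNReal.ofReal_mul (Real.exp_pos _).le, ← Real.exp_add] at h2
      refine le_trans (ENNReal.ofReal_le_ofReal (Real.exp_le_exp.2 ?_)) h2
      have h3 : 0 ≤ birkhoffSum T g (1 + r) x := Finset.sum_nonneg fun _ _ => hg _
      have h4 : ((1 : ℝ) + r) * B ≤ K * B :=
        mul_le_mul_of_nonneg_right (by exact_mod_cast (hmn.trans_le hmK).le) hB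
      linarith

lemma limsup_partEnt_le [MeasurableSpace X] {μ : Measure X} [IsProbabilityMeasure μ] {k : ℕ}
    {T : X → X} (hT : MeasurePreserving T μ μ) {P : X → Fin k} (hP : Measurable P)
    {c : List (Fin k) → ℝ≥0∞} (hc : ∑' u, c u ≤ 1)
    {g : X → ℝ} (hgi : Integrable g μ) (hg : ∀ x, 0 ≤ g x) {K : ℕ} {B : ℝ} (hB : 0 ≤ B)
    (hsingle : ∀ a, ENNReal.ofReal (Real.exp (-B)) ≤ c [a])
    (hblock : ∀ x, ∃ m, 0 < m ∧ m ≤ K ∧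
      ENNReal.ofReal (Real.exp (-birkhoffSum T g m x)) ≤ c (word T P m x)) :
    limsup (fun n : ℕ =>
      ENNReal.ofReal (partEnt μ (fun x => fun j : Fin n => P (T^[(j : ℕ)] x)) / n)) atTop
      ≤ ENNReal.ofReal (∫ x, g x ∂μ) := by
  have hbound : ∀ n : ℕ, partEnt μ (fun x => fun j : Fin n => P (T^[(j : ℕ)] x))
      ≤ n * ∫ x, g x ∂μ + K * B := by
    intro n
    obtain ⟨q, hq1, -, hq3⟩ := exists_word_weight hc hg hB hsingle hblock n
    have hint : ∀ j : ℕ, Integrable (fun x => g (T^[j] x)) μ := fun j =>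
      (hT.iterate j).integrable_comp_of_integrable hgi
    have hsumi : Integrable (fun x => birkhoffSum T g n x) μ :=
      integrable_finsetSum _ fun j _ => hint j
    have hval : ∀ j : ℕ, ∫ x, g (T^[j] x) ∂μ = ∫ x, g x ∂μ := by
      intro j
      have hj := hT.iterate j
      conv_rhs => rw [← hj.map_eq]
      rw [integral_map hj.measurable.aemeasurable]
      rw [hj.map_eq]
      exact hgi.aestronglyMeasurable
    have h := partEnt_le_integral (μ := μ)
      (P := fun x => fun j : Fin n => P (T^[(j : ℕ)] x))
      (q := fun w => q (List.ofFn w)) (h := fun x => birkhoffSum T g n x + K * B)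
      (measurable_pi_lambda _ fun j => hP.comp (hT.measurable.iterate _)) ?_
      (hsumi.add (integrable_const _)) fun x => by rw [← word_eq_ofFn]; exact hq3 x
    · rw [integral_add hsumi (integrable_const _)] at h
      simp only [birkhoffSum] at h
      rw [integral_finsetSum _ fun j _ => hint j] at h
      simpa [hval] using h
    · rw [← tsum_fintype (L := .unconditional _)]
      refine le_trans ?_ hq1
      refine le_trans (le_of_eq ?_) (ENNReal.tsum_comp_le_tsum_of_injective
        (List.ofFn_injective (n := n) (α := Fin k)) _)
      simp
  have hlim : Tendsto (fun n : ℕ => ENNReal.ofReal (∫ x, g x ∂μ + K * B / n)) atTop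
      (𝓝 (ENNReal.ofReal (∫ x, g x ∂μ))) := by
    refine ENNReal.tendsto_ofReal ?_
    simpa using (tendsto_const_div_atTop_nhds_zero_nat (K * B)).const_add (∫ x, g x ∂μ)
  rw [← hlim.limsup_eq]
  refine limsup_le_limsup ?_
  filter_upwards [eventually_gt_atTop 0] with n hn
  have hn' : (0 : ℝ) < n := by exact_mod_cast hn
  refine ENNReal.ofReal_le_ofReal ?_
  rw [div_le_iff₀ hn', add_mul, div_mul_cancel₀ _ hn'.ne']
  linarith [hbound n]

/-- The product weight of a word, with factor `p` at letters agreeing with `γ` and `r`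
elsewhere. -/
noncomputable def guessWeight [DecidableEq A] (p r : ℝ≥0∞) : (ℕ → A) → List A → ℝ≥0∞
  | _, [] => 1
  | γ, a :: u => (if a = γ 0 then p else r) * guessWeight p r (fun j => γ (j + 1)) u

lemma tsum_guessWeight_le [DecidableEq A] [Fintype A] {p r : ℝ≥0∞}
    (hpr : p + Fintype.card A * r ≤ 1) (γ : ℕ → A) (m : ℕ) :
    (∑' u : List A, if u.length = m then guessWeight p r γ u else 0) ≤ 1 := by
  induction m generalizing γ with
  | zero =>
    rw [tsum_eq_single ([] : List A)]
    · simp [guessWeight]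
    · intro l hl
      simp [hl]
  | succ m ih =>
    have hinj : Function.Injective fun x : A × List A => x.1 :: x.2 := by
      rintro ⟨a, u⟩ ⟨b, v⟩ h
      simpa using h
    rw [← hinj.tsum_eq, ENNReal.tsum_prod']
    · calc _ = ∑' a : A, (if a = γ 0 then p else r) * ∑' u : List A,
            if u.length = m then guessWeight p r (fun j => γ (j + 1)) u else 0 := by
            refine tsum_congr fun a => ?_
            rw [← ENNReal.tsum_mul_left]
            refine tsum_congr fun u => ?_
            simp [guessWeight]
        _ ≤ ∑' a : A, (if a = γ 0 then p else r) * 1 := by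
            gcongr
            exact ih _
        _ ≤ ∑ a : A, ((if a = γ 0 then p else 0) + r) := by
            rw [tsum_fintype]
            refine Finset.sum_le_sum fun a _ => ?_
            split_ifs <;> simp
        _ ≤ 1 := by
            rw [Finset.sum_add_distrib]
            simpa using hpr
    · intro u hu
      cases u with
      | nil => simp at hu
      | cons a u => exact ⟨(a, u), rfl⟩

lemma le_guessWeight_word [DecidableEq A] {T : X → X} {P : X → A} {R : Set X} {p r : ℝ≥0∞}
    {g : X → ℝ} (hp : ∀ x, ENNReal.ofReal (Real.exp (-g x)) ≤ p)
    (hr : ∀ x ∈ R, ENNReal.ofReal (Real.exp (-g x)) ≤ r) (m : ℕ) (γ : ℕ → A) (x : X)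
    (h : ∀ j < m, T^[j] x ∉ R → P (T^[j] x) = γ j) :
    ENNReal.ofReal (Real.exp (-birkhoffSum T g m x)) ≤ guessWeight p r γ (word T P m x) := by
  induction m generalizing γ x with
  | zero => simp [word, guessWeight]
  | succ m ih =>
    have hrec := ih (fun j => γ (j + 1)) (T x) fun j hj hR => h (j + 1) (by omega) hR
    have hfirst : ENNReal.ofReal (Real.exp (-g x)) ≤ if P x = γ 0 then p else r := by
      split_ifs with h0
      · exact hp x
      · exact hr x (by_contra fun hR => h0 (h 0 (by omega) hR))
    have := mul_le_mul' hfirst hrec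
    rw [← ENNReal.ofReal_mul (Real.exp_pos _).le, ← Real.exp_add] at this
    rw [birkhoffSum_succ', neg_add]
    exact this

end Coding

section Labels

lemma exists_label [PseudoMetricSpace X] [CompactSpace X] [MeasurableSpace X] [BorelSpace X]
    (μ : Measure X) [IsFiniteMeasure μ] {k : ℕ} {P : X → Fin k} (hP : Measurable P)
    {r : ℝ≥0∞} (hr : r ≠ 0) :
    ∃ R : Set X, MeasurableSet R ∧ μ R ≤ r ∧ ∃ η > 0, ∃ label : X → Fin k,
      ∀ y ∉ R, ∀ z, dist y z < η → label z = P y := by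
  have hex : ∀ a : Fin k, ∃ C ⊆ P ⁻¹' {a}, IsCompact C ∧ IsClosed C ∧
      μ (P ⁻¹' {a} \ C) < r / k := by
    intro a
    have hm : MeasurableSet (P ⁻¹' {a}) := hP (measurableSet_singleton a)
    obtain ⟨C, hC, hCc, hCm⟩ := hm.exists_isClosed_sdiff_lt (measure_ne_top μ _)
      (ε := r / k) (by simpa using hr)
    exact ⟨C, hC, hCc.isCompact, hCc, hCm⟩
  choose C hCP hCc hCcl hCμ using hex
  have hsep : ∀ᶠ η : ℝ in 𝓝[>] 0, ∀ a b : Fin k, a ≠ b →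
      Disjoint (Metric.thickening η (C a)) (Metric.thickening η (C b)) := by
    refine eventually_all.2 fun a => eventually_all.2 fun b => ?_
    by_cases hab : a = b
    · simp [hab]
    have hd : Disjoint (C a) (C b) :=
      (Disjoint.preimage P (disjoint_singleton.2 hab)).mono (hCP a) (hCP b)
    obtain ⟨δ, hδ, hdδ⟩ := hd.exists_thickenings (hCc a) (hCcl b)
    filter_upwards [Ioo_mem_nhdsGT hδ] with η hη _
    exact hdδ.mono (Metric.thickening_mono hη.2.le _) (Metric.thickening_mono hη.2.le _)
  obtain ⟨η, hη, hη0⟩ := (hsep.and self_mem_nhdsWithin).exists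
  refine ⟨(⋃ a, C a)ᶜ, (MeasurableSet.iUnion fun a => (hCcl a).measurableSet).compl, ?_, η, hη0,
    ?_⟩
  · calc μ (⋃ a, C a)ᶜ ≤ μ (⋃ a, P ⁻¹' {a} \ C a) := by
          refine measure_mono fun x hx => mem_iUnion.2 ⟨P x, rfl, fun h => hx (mem_iUnion.2 ⟨_, h⟩)⟩
      _ ≤ ∑ a, μ (P ⁻¹' {a} \ C a) := measure_iUnion_fintype_le _ _
      _ ≤ ∑ _a : Fin k, r / k := Finset.sum_le_sum fun a _ => (hCμ a).le
      _ ≤ r := by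
        simp only [Finset.sum_const, Finset.card_univ, Fintype.card_fin, nsmul_eq_mul]
        exact ENNReal.mul_div_le
  · classical
    refine ⟨fun z => if h : ∃ a, z ∈ Metric.thickening η (C a) then h.choose else P z,
      fun y hy z hyz => ?_⟩
    obtain ⟨a, ha⟩ := mem_iUnion.1 (not_not.1 hy)
    have hya : P y = a := hCP a ha
    have hz : z ∈ Metric.thickening η (C a) := Metric.mem_thickening_iff.2 ⟨y, ha, by
      rwa [dist_comm]⟩
    have h : ∃ a, z ∈ Metric.thickening η (C a) := ⟨a, hz⟩
    simp only [h, dif_pos]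
    rw [hya]
    by_contra hne
    exact disjoint_left.1 (hη _ _ hne) h.choose_spec hz

end Labels

section Cover

lemma exists_cover_of_coverMlim_eq_zero [PseudoMetricSpace X] {φ : ℝ → X → X} {Z : Set X} {s : ℝ}
    (h : coverMlim φ Z s = 0) {ε : ℝ} (hε : 0 < ε) (N : ℕ) {τ : ℝ≥0∞} (hτ : 0 < τ) :
    ∃ F : Set (X × ℝ), F.Countable ∧ (∀ p ∈ F, (N : ℝ) ≤ p.2) ∧
      Z ⊆ ⋃ p ∈ F, reparBall φ p.1 p.2 ε ∧
      ∑' p : F, ENNReal.ofReal (Real.exp (-s * (p : X × ℝ).2)) < τ := by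
  simp only [coverMlim, coverMeps, ENNReal.iSup_eq_zero] at h
  have h0 := (h ε hε N).trans_lt hτ
  simp only [coverM, iInf_lt_iff] at h0
  obtain ⟨F, h1, h2, h3, h4⟩ := h0
  exact ⟨F, h1, h2, h3, h4⟩

variable {A β I : Type*}

/-- Code weight built from a family of guessed label sequences and from single letters. -/
noncomputable def codeWeight [DecidableEq A] (e p r : ℝ≥0∞) (w : I → ℝ≥0∞) (S : I → Finset β)
    (m : I → ℕ) (γ : β → ℕ → A) (u : List A) : ℝ≥0∞ :=
  (if u.length = 1 then e else 0) +
    ∑' i, ∑ b ∈ S i, w i * if u.length = m i then guessWeight p r (γ b) u else 0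

lemma tsum_codeWeight_le [DecidableEq A] [Fintype A] {e p r : ℝ≥0∞}
    (hpr : p + Fintype.card A * r ≤ 1) (w : I → ℝ≥0∞) (S : I → Finset β)
    (m : I → ℕ) (γ : β → ℕ → A) (h : Fintype.card A * e + ∑' i, (S i).card * w i ≤ 1) :
    ∑' u, codeWeight e p r w S m γ u ≤ 1 := by
  refine le_trans ?_ h
  simp only [codeWeight]
  rw [ENNReal.tsum_add, ENNReal.tsum_comm]
  refine add_le_add (le_of_eq ?_) (ENNReal.tsum_le_tsum fun i => ?_)
  · have hinj : Function.Injective fun a : A => [a] := fun a b h => by simpa using h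
    rw [← hinj.tsum_eq]
    · simp
    · intro u hu
      have hu1 : u.length = 1 := by
        by_contra h1
        simp [h1] at hu
      obtain ⟨a, rfl⟩ := List.length_eq_one_iff.1 hu1
      exact ⟨a, rfl⟩
  · rw [Summable.tsum_finsetSum fun _ _ => ENNReal.summable, ← nsmul_eq_mul]
    refine Finset.sum_le_card_nsmul _ _ _ fun b _ => ?_
    rw [ENNReal.tsum_mul_left]
    exact mul_le_of_le_one_right' (tsum_guessWeight_le hpr _ _)

lemma le_codeWeight_of_mem [DecidableEq A] {e p r : ℝ≥0∞} {w : I → ℝ≥0∞} {S : I → Finset β}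
    {m : I → ℕ} {γ : β → ℕ → A} {i : I} {b : β} (hb : b ∈ S i) {u : List A}
    (hu : u.length = m i) : w i * guessWeight p r (γ b) u ≤ codeWeight e p r w S m γ u := by
  refine le_trans ?_ le_add_self
  refine le_trans ?_ (ENNReal.le_tsum i)
  refine le_trans (le_of_eq ?_) (Finset.single_le_sum (fun _ _ => zero_le) hb)
  simp [hu]

lemma le_codeWeight_singleton [DecidableEq A] (e p r : ℝ≥0∞) (w : I → ℝ≥0∞) (S : I → Finset β)
    (m : I → ℕ) (γ : β → ℕ → A) (a : A) : e ≤ codeWeight e p r w S m γ [a] := by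
  simp [codeWeight]

lemma exists_finite_subcover_ae [PseudoMetricSpace X] [CompactSpace X] [MeasurableSpace X]
    [BorelSpace X] (μ : Measure X) [IsFiniteMeasure μ] {I : Type*}
    {b : Set I} {V : I → Set X} (hV : ∀ i ∈ b, IsOpen (V i))
    (hμ : ∀ᵐ x ∂μ, x ∈ ⋃ i ∈ b, V i) {τ : ℝ≥0∞} (hτ : τ ≠ 0) :
    ∃ b' ⊆ b, b'.Finite ∧ μ (⋃ i ∈ b', V i)ᶜ ≤ τ := by
  have hVo : IsOpen (⋃ i ∈ b, V i) := isOpen_biUnion hV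
  obtain ⟨C, hCV, hC, hCμ⟩ := hVo.measurableSet.exists_isClosed_sdiff_lt
    (measure_ne_top μ _) hτ
  obtain ⟨b', hb', hfin, hCb⟩ := hC.isCompact.elim_finite_subcover_image hV hCV
  refine ⟨b', hb', hfin, ?_⟩
  calc μ (⋃ i ∈ b', V i)ᶜ ≤ μ ((⋃ i ∈ b, V i) \ C ∪ (⋃ i ∈ b, V i)ᶜ) := by
        refine measure_mono fun x hx => ?_
        by_cases hxV : x ∈ ⋃ i ∈ b, V i
        · exact Or.inl ⟨hxV, fun hxC => hx (hCb hxC)⟩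
        · exact Or.inr hxV
    _ ≤ μ ((⋃ i ∈ b, V i) \ C) + μ (⋃ i ∈ b, V i)ᶜ := measure_union_le _ _
    _ ≤ τ := by
        have h0 : μ (⋃ i ∈ b, V i)ᶜ = 0 := hμ
        rw [h0, add_zero]
        exact hCμ.le

lemma integral_const_mul_indicator_le [MeasurableSpace X] {μ : Measure X} [IsFiniteMeasure μ]
    {R : Set X} (hR : MeasurableSet R) {b δ : ℝ} (hb : 0 ≤ b) (hδ : 0 ≤ δ)
    (h : μ R ≤ ENNReal.ofReal (δ / (b + 1))) : ∫ x, R.indicator (fun _ => b) x ∂μ ≤ δ := by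
  rw [integral_indicator_const _ hR, smul_eq_mul]
  have h1 : μ.real R ≤ δ / (b + 1) := ENNReal.toReal_le_of_le_ofReal (by positivity) h
  calc μ.real R * b ≤ δ / (b + 1) * (b + 1) := by gcongr; linarith
    _ = δ := by field_simp

lemma limsup_partEnt_le_of_coverMlim_eq_zero [MetricSpace X] [CompactSpace X] [MeasurableSpace X]
    [BorelSpace X] {φ : ℝ → X → X} (hφ : IsFlow φ) (hfp : FixedPointFree φ) {μ : Measure X}
    [IsProbabilityMeasure μ] (hinv : FlowInvariant φ μ) {Z : Set X} (hZ : ∀ᵐ x ∂μ, x ∈ Z)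
    {k : ℕ} {P : X → Fin k} (hP : Measurable P) {s : ℝ} (hs : 0 ≤ s)
    (h : coverMlim φ Z s = 0) {δ : ℝ} (hδ : 0 < δ) :
    limsup (fun n : ℕ =>
      ENNReal.ofReal (partEnt μ (fun x => fun j : Fin n => P ((φ 1)^[(j : ℕ)] x)) / n)) atTop
      ≤ ENNReal.ofReal (s + 5 * δ) := by
  obtain ⟨x₀⟩ : Nonempty X := nonempty_of_isProbabilityMeasure μ
  have hk : 1 ≤ k := (P x₀).pos
  have hk' : (1 : ℝ) ≤ k := by exact_mod_cast hk
  set B : ℝ := Real.log (2 * k) with hBdef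
  have hB : 0 ≤ B := Real.log_nonneg (by linarith)
  have hexpB : Real.exp (-B) = 1 / (2 * k) := by
    rw [Real.exp_neg, hBdef, Real.exp_log (by linarith), one_div]
  have hδ1 : Real.exp (-δ) < 1 := Real.exp_lt_one_iff.mpr (by linarith)
  have hδ0 := Real.exp_pos (-δ)
  have hq : 0 < (1 - Real.exp (-δ)) / k := div_pos (by linarith) (by linarith)
  set b : ℝ := -Real.log ((1 - Real.exp (-δ)) / k) with hbdef
  have hb : 0 ≤ b := by
    have := Real.log_nonpos hq.le (by rw [div_le_one (by linarith)]; linarith)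
    linarith
  have hexpb : Real.exp (-b) = (1 - Real.exp (-δ)) / k := by
    rw [hbdef, neg_neg, Real.exp_log hq]
  obtain ⟨R, hR, hRμ, η, hη, label, hlabel⟩ := exists_label μ hP
    (r := ENNReal.ofReal (δ / (b + 1))) (by simpa using div_pos hδ (by linarith))
  obtain ⟨ε, hε, htrack⟩ := hφ.exists_reparBall_tracked hfp hη hδ
  obtain ⟨N, hN⟩ := exists_nat_ge (max 1 ((s + δ) / δ))
  obtain ⟨F, hFc, hFN, hZF, hFsum⟩ := exists_cover_of_coverMlim_eq_zero h hε N
    (τ := 2⁻¹) (by simp)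
  have hN1 : 1 ≤ N := by exact_mod_cast (le_max_left _ _).trans hN
  have hN2 : s + δ ≤ δ * N := by
    have := (le_max_right _ _).trans hN
    rwa [div_le_iff₀ hδ, mul_comm] at this
  have hFt : ∀ i : F, 0 ≤ (i : X × ℝ).2 := fun i => (Nat.cast_nonneg N).trans (hFN i i.2)
  choose S hScard hS using fun i : F => htrack (i : X × ℝ).1 (i : X × ℝ).2 (hFt i)
  obtain ⟨F₀, hF₀F, hF₀, hF₀μ⟩ := exists_finite_subcover_ae μ (b := F)
    (V := fun i => reparBall φ i.1 i.2 ε) (fun i _ => hφ.isOpen_reparBall _ _ _)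
    (hZ.mono fun x hx => hZF hx) (τ := ENNReal.ofReal (δ / (B + 1)))
    (by simpa using div_pos hδ (by linarith))
  set U : Set X := (⋃ i ∈ F₀, reparBall φ i.1 i.2 ε)ᶜ with hUdef
  have hU : MeasurableSet U :=
    (isOpen_biUnion fun i _ => hφ.isOpen_reparBall _ _ _).measurableSet.compl
  set p := ENNReal.ofReal (Real.exp (-δ)) with hp
  set r := ENNReal.ofReal (Real.exp (-b)) with hr
  let m : F → ℕ := fun i => ⌊(i : X × ℝ).2⌋₊
  let w : F → ℝ≥0∞ := fun i => ENNReal.ofReal (Real.exp (-((s + δ) * (i : X × ℝ).2)))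
  let c : List (Fin k) → ℝ≥0∞ := codeWeight (ENNReal.ofReal (Real.exp (-B))) p r w S m
    fun y j => label (y j)
  have hpr : p + Fintype.card (Fin k) * r ≤ 1 := by
    rw [Fintype.card_fin, hp, hr, hexpb, ← ENNReal.ofReal_natCast k,
      ← ENNReal.ofReal_mul (by linarith), ← ENNReal.ofReal_add hδ0.le (by positivity)]
    refine ENNReal.ofReal_le_one.2 (le_of_eq ?_)
    field_simp
    ring
  have hc : ∑' u, c u ≤ 1 := by
    refine tsum_codeWeight_le hpr _ _ _ _ ?_
    have h1 : (Fintype.card (Fin k) : ℝ≥0∞) * ENNReal.ofReal (Real.exp (-B)) ≤ 2⁻¹ := by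
      rw [Fintype.card_fin, hexpB, ← ENNReal.ofReal_natCast k,
        ← ENNReal.ofReal_mul (by linarith), ← ENNReal.ofReal_ofNat 2,
        ← ENNReal.ofReal_inv_of_pos two_pos]
      refine ENNReal.ofReal_le_ofReal (le_of_eq ?_)
      field_simp
    have h2 : ∀ i : F, ((S i).card : ℝ≥0∞) * w i
        ≤ ENNReal.ofReal (Real.exp (-s * (i : X × ℝ).2)) := by
      intro i
      rw [← ENNReal.ofReal_natCast, ← ENNReal.ofReal_mul (by positivity)]
      refine ENNReal.ofReal_le_ofReal ((mul_le_mul_of_nonneg_right (hScard i)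
        (Real.exp_pos _).le).trans (le_of_eq ?_))
      rw [← Real.exp_add]
      ring_nf
    calc _ ≤ 2⁻¹ + (2⁻¹ : ℝ≥0∞) := add_le_add h1 ((ENNReal.tsum_le_tsum h2).trans hFsum.le)
      _ = 1 := ENNReal.inv_two_add_inv_two
  let g₁ : X → ℝ := fun x => δ + R.indicator (fun _ => b) x
  let g : X → ℝ := fun x => (s + 2 * δ) + g₁ x + U.indicator (fun _ => B) x
  have hRnn : ∀ x, 0 ≤ R.indicator (fun _ => b) x := indicator_nonneg fun _ _ => hb
  have hUnn : ∀ x, 0 ≤ U.indicator (fun _ => B) x := indicator_nonneg fun _ _ => hB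
  have hg₁ : ∀ x, 0 ≤ g₁ x := fun x => add_nonneg hδ.le (hRnn x)
  have hg : ∀ x, 0 ≤ g x := fun x => add_nonneg (add_nonneg (by linarith) (hg₁ x)) (hUnn x)
  have hRi : Integrable (R.indicator fun _ => b) μ := (integrable_const b).indicator hR
  have hUi : Integrable (U.indicator fun _ => B) μ := (integrable_const B).indicator hU
  have hg₁i : Integrable g₁ μ := (integrable_const δ).add hRi
  have hg₂i : Integrable (fun x => (s + 2 * δ) + g₁ x) μ := (integrable_const _).add hg₁i
  have hgi : Integrable g μ := hg₂i.add hUi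
  have hint : ∫ x, g x ∂μ ≤ s + 5 * δ := by
    have e1 : ∫ x, g x ∂μ = s + 2 * δ + (δ + ∫ x, R.indicator (fun _ => b) x ∂μ)
        + ∫ x, U.indicator (fun _ => B) x ∂μ := by
      simp only [g, g₁]
      rw [integral_add hg₂i hUi, integral_add (integrable_const _) hg₁i,
        integral_add (integrable_const _) hRi]
      simp
    have e2 := integral_const_mul_indicator_le hR hb hδ.le hRμ
    have e3 := integral_const_mul_indicator_le hU hB hδ.le hF₀μ
    linarith
  have hbdd : BddAbove ((fun i : X × ℝ => ⌊i.2⌋₊) '' F₀) := (hF₀.image _).bddAbove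
  obtain ⟨K, hK⟩ := hbdd
  refine (limsup_partEnt_le (hinv 1) hP hc hgi hg (K := max 1 K) hB
    (fun a => le_codeWeight_singleton _ _ _ _ _ _ _ a) fun x => ?_).trans
    (ENNReal.ofReal_le_ofReal hint)
  by_cases hx : x ∈ U
  · refine ⟨1, one_pos, le_max_left _ _, ?_⟩
    rw [word_one, birkhoffSum_one]
    refine le_trans (ENNReal.ofReal_le_ofReal (Real.exp_le_exp.2 ?_))
      (le_codeWeight_singleton _ _ _ _ _ _ _ _)
    have := hg₁ x
    simp only [g, indicator_of_mem hx]
    linarith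
  · rw [hUdef, notMem_compl_iff] at hx
    obtain ⟨i, hi, hxi⟩ := mem_iUnion₂.1 hx
    have hiF := hF₀F hi
    obtain ⟨y, hyS, hy⟩ := hS ⟨i, hiF⟩ x hxi
    have hNm : N ≤ ⌊i.2⌋₊ := Nat.le_floor (hFN i hiF)
    refine ⟨⌊i.2⌋₊, hN1.trans hNm, le_max_of_le_right (hK ⟨i, hi, rfl⟩), ?_⟩
    refine le_trans ?_ (le_codeWeight_of_mem (i := (⟨i, hiF⟩ : F)) hyS (length_word _ _ _ _))
    have hgw := le_guessWeight_word (T := φ 1) (P := P) (R := R) (p := p) (r := r) (g := g₁)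
      (fun z => ENNReal.ofReal_le_ofReal (Real.exp_le_exp.2 (by
        have := hRnn z
        simp only [g₁]
        linarith)))
      (fun z hz => ENNReal.ofReal_le_ofReal (Real.exp_le_exp.2 (by
        simp only [g₁, indicator_of_mem hz]
        linarith))) ⌊i.2⌋₊ (fun j => label (y j)) x (fun j hj hjR => by
        rw [hφ.iterate_one] at hjR ⊢
        exact (hlabel _ hjR _ (hy j ((Nat.le_floor_iff (hFt ⟨i, hiF⟩)).1 hj.le))).symm)
    refine le_trans ?_ (mul_le_mul' le_rfl hgw)
    rw [← ENNReal.ofReal_mul (Real.exp_pos _).le, ← Real.exp_add]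
    refine ENNReal.ofReal_le_ofReal (Real.exp_le_exp.2 ?_)
    have hbs : (⌊i.2⌋₊ : ℝ) * (s + 2 * δ) + birkhoffSum (φ 1) g₁ ⌊i.2⌋₊ x
        ≤ birkhoffSum (φ 1) g ⌊i.2⌋₊ x := by
      simp only [birkhoffSum]
      rw [← nsmul_eq_mul, ← Finset.card_range ⌊i.2⌋₊, ← Finset.sum_const, Finset.card_range,
        ← Finset.sum_add_distrib]
      exact Finset.sum_le_sum fun j _ => le_add_of_nonneg_right (hUnn _)
    have hfl := Nat.lt_floor_add_one i.2
    have hNm' : (N : ℝ) ≤ ⌊i.2⌋₊ := by exact_mod_cast hNm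
    have e1 : (s + δ) * i.2 ≤ (s + δ) * (⌊i.2⌋₊ + 1) := by gcongr
    have e2 : δ * N ≤ δ * ⌊i.2⌋₊ := by gcongr
    nlinarith

end Cover

/-- **Corollary.** For a compact metric flow `φ` without fixed points and an ergodic
`φ`-invariant Borel probability measure `μ`, `h_μ(φ₁) ≤ h_top^B(φ, G_μ(φ))`. -/
theorem kolSinai_le_bowenEntropy_genericPts {X : Type*} [MetricSpace X] [CompactSpace X]
    [MeasurableSpace X] [BorelSpace X] (φ : ℝ → X → X) (hφ : IsFlow φ)
    (hfp : FixedPointFree φ) (μ : Measure X) [IsProbabilityMeasure μ]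
    (herg : FlowErgodic φ μ) :
    kolSinai μ (φ 1) ≤ bowenEntropy φ (genericPts φ μ) := by
  refine iSup_le fun k => iSup_le fun P => iSup_le fun hP => ?_
  refine le_iInf fun s => le_iInf fun hs => le_iInf fun h0 => ?_
  have hlim : Tendsto (fun δ : ℝ => ENNReal.ofReal (s + 5 * δ)) (𝓝[>] 0)
      (𝓝 (ENNReal.ofReal s)) := by
    refine ENNReal.tendsto_ofReal (Tendsto.mono_left ?_ nhdsWithin_le_nhds)
    exact Continuous.tendsto' (by fun_prop) _ _ (by simp)
  refine ge_of_tendsto hlim ?_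
  filter_upwards [self_mem_nhdsWithin] with δ hδ
  exact limsup_partEnt_le_of_coverMlim_eq_zero hφ hfp herg.1 (hφ.ae_mem_genericPts herg) hP hs h0
    hδ

end FlowEntropy
end

section
/- Let (X,d) be a compact metric space, φ a continuous flow on X without fixed points, μ an ergodic φ-invariant Borel probability measure, E a Borel subset of X, and 0<s<∞. If the lower local entropy satisfies underline h_μ(φ,x) ≥ s for every x∈E and μ(E)>0, then h_top^B(φ, E) ≥ s. -/
open MeasureTheory Filter Set Topology
open scoped ENNReal NNReal

namespace FlowEntropy

variable {X : Type*}

/-- A fixed point free flow on a compact space has no closed orbits of small period. -/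
theorem FixedPointFree.exists_no_small_period [TopologicalSpace X] [T2Space X] [CompactSpace X]
    {φ : ℝ → X → X} (hφ : IsFlow φ) (hfp : FixedPointFree φ) :
    ∃ r > 0, ∀ x : X, ∀ T : ℝ, 0 < T → T < r → φ T x ≠ x := by
  have key : ∃ r > 0, ∀ x ∈ (univ : Set X), ∀ T : ℝ, 0 < T → T < r → φ T x ≠ x := by
    refine isCompact_univ.induction_on
      (p := fun S : Set X => ∃ r > 0, ∀ x ∈ S, ∀ T : ℝ, 0 < T → T < r → φ T x ≠ x) ?_ ?_ ?_ ?_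
    · exact ⟨1, one_pos, by simp⟩
    · rintro S S' hS ⟨r, hr, h⟩
      exact ⟨r, hr, fun x hx => h x (hS hx)⟩
    · rintro S S' ⟨r, hr, h⟩ ⟨r', hr', h'⟩
      refine ⟨min r r', lt_min hr hr', ?_⟩
      rintro x (hx | hx) T hT hTr
      · exact h x hx T hT (hTr.trans_le (min_le_left _ _))
      · exact h' x hx T hT (hTr.trans_le (min_le_right _ _))
    · intro x _
      obtain ⟨t, ht⟩ := hfp x
      have hne : ∀ᶠ p : ℝ × X in 𝓝 (t, x), φ p.1 p.2 ≠ p.2 :=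
        (isOpen_ne_fun hφ.cont continuous_snd).mem_nhds ht
      rw [nhds_prod_eq] at hne
      obtain ⟨pa, ha, pb, hb, hab⟩ := eventually_prod_iff.1 hne
      obtain ⟨r, hr, hra⟩ := Metric.eventually_nhds_iff.1 ha
      refine ⟨{y | pb y}, mem_nhdsWithin_of_mem_nhds hb, r, hr, fun y hy T hT hTr hper => ?_⟩
      have hmul : ∀ k : ℤ, φ (k * T) y = y := by
        have hneg : φ (-T) y = y := by
          conv_lhs => rw [← hper]
          rw [← hφ.map_add, neg_add_cancel, hφ.map_zero]
        intro k
        induction k using Int.induction_on with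
        | zero => simp [hφ.map_zero]
        | succ i ih =>
          push_cast at ih ⊢
          rw [add_mul, one_mul, hφ.map_add, hper, ih]
        | pred i ih =>
          push_cast at ih ⊢
          rw [sub_mul, one_mul, sub_eq_add_neg, hφ.map_add, hneg, ih]
      refine hab (x := ⌊t / T⌋ * T) (hra ?_) hy (hmul _)
      have h1 := Int.floor_le (t / T)
      have h2 := Int.lt_floor_add_one (t / T)
      rw [le_div_iff₀ hT] at h1
      rw [div_lt_iff₀ hT] at h2
      rw [Real.dist_eq, abs_lt]
      constructor <;> linarith
  obtain ⟨r, hr, h⟩ := key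
  exact ⟨r, hr, fun x => h x (mem_univ x)⟩

/-- A continuous time change along which two orbits of a fixed point free flow stay close drifts
little from the identity during a unit of time. -/
theorem FixedPointFree.exists_drift_lt [MetricSpace X] [CompactSpace X]
    {φ : ℝ → X → X} (hφ : IsFlow φ) (hfp : FixedPointFree φ) {η : ℝ} (hη : 0 < η) :
    ∃ ε > 0, ∀ (x y : X) (α : ℝ → ℝ) (t : ℝ), 0 ≤ t → t ≤ 1 → ContinuousOn α (Icc 0 t) →
      α 0 = 0 → (∀ s ∈ Icc 0 t, dist (φ (α s) x) (φ s y) < ε) → |α t - t| < η := by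
  obtain ⟨r, hr, hper⟩ := hfp.exists_no_small_period hφ
  obtain ⟨κ, hκ, hκη, hκr⟩ : ∃ κ > 0, κ ≤ η ∧ κ < r :=
    ⟨min η (r / 2), lt_min hη (by linarith), min_le_left _ _,
      (min_le_right _ _).trans_lt (by linarith)⟩
  obtain ⟨c, hc, hcdist⟩ : ∃ c > 0, ∀ z, c ≤ dist (φ κ z) z := by
    rcases isEmpty_or_nonempty X with hX | hX
    · exact ⟨1, one_pos, fun z => hX.elim z⟩
    · have hcont : Continuous fun z => dist (φ κ z) z :=
        (hφ.cont.comp (by fun_prop : Continuous fun z : X => (κ, z))).dist continuous_id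
      obtain ⟨z, -, hz⟩ := isCompact_univ.exists_isMinOn univ_nonempty hcont.continuousOn
      exact ⟨_, dist_pos.2 (hper z κ hκ hκr), fun w => hz (mem_univ w)⟩
  obtain ⟨δ, hδ, hunif⟩ : ∃ δ > 0, ∀ s ∈ Icc (0 : ℝ) 1, ∀ x y : X, dist x y < δ →
      dist (φ s x) (φ s y) < c / 2 := by
    have hu : UniformContinuousOn (fun p : ℝ × X => φ p.1 p.2) (Icc 0 1 ×ˢ univ) :=
      (isCompact_Icc.prod isCompact_univ).uniformContinuousOn_of_continuous hφ.cont.continuousOn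
    obtain ⟨δ, hδ, h⟩ := Metric.uniformContinuousOn_iff.1 hu (c / 2) (by linarith)
    refine ⟨δ, hδ, fun s hs x y hxy => h (s, x) ⟨hs, mem_univ _⟩ (s, y) ⟨hs, mem_univ _⟩ ?_⟩
    simpa [Prod.dist_eq, hδ] using hxy
  refine ⟨min δ (c / 2), lt_min hδ (by linarith), fun x y α t ht0 ht1 hα hα0 hclose => ?_⟩
  refine lt_of_lt_of_le ?_ hκη
  by_contra! hge
  have hcont : ContinuousOn (fun s => |α s - s|) (Icc 0 t) := (hα.sub continuousOn_id).abs
  obtain ⟨u, hu, hueq⟩ := intermediate_value_Icc ht0 hcont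
    (show κ ∈ Icc _ _ from ⟨by simp [hα0, hκ.le], hge⟩)
  have h0 := hclose 0 ⟨le_rfl, ht0⟩
  rw [hα0, hφ.map_zero, hφ.map_zero] at h0
  have h1 := hunif u ⟨hu.1, hu.2.trans ht1⟩ x y (h0.trans_le (min_le_left _ _))
  have h2 := (hclose u hu).trans_le (min_le_right _ _)
  have h3 : dist (φ (α u) x) (φ u x) < c := by
    have := dist_triangle_right (φ (α u) x) (φ u x) (φ u y)
    linarith
  rcases (abs_eq hκ.le).1 hueq with h | h
  · have h4 := hcdist (φ u x)
    rw [← hφ.map_add, show κ + u = α u by linarith] at h4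
    linarith
  · have h4 := hcdist (φ (α u) x)
    rw [← hφ.map_add, show κ + α u = u by linarith, dist_comm] at h4
    linarith

/-- A continuous time change along which two orbits of a fixed point free flow stay close drifts
from the identity at most at a small linear rate. -/
theorem FixedPointFree.exists_drift_le [MetricSpace X] [CompactSpace X]
    {φ : ℝ → X → X} (hφ : IsFlow φ) (hfp : FixedPointFree φ) {η : ℝ} (hη : 0 < η) :
    ∃ ε > 0, ∀ (x y : X) (α : ℝ → ℝ) (t : ℝ), ContinuousOn α (Icc 0 t) → α 0 = 0 →
      (∀ s ∈ Icc 0 t, dist (φ (α s) x) (φ s y) < ε) →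
      ∀ s ∈ Icc 0 t, |α s - s| ≤ η * (s + 1) := by
  obtain ⟨ε, hε, h⟩ := hfp.exists_drift_lt hφ hη
  refine ⟨ε, hε, fun x y α t hα hα0 hclose => ?_⟩
  have key : ∀ n : ℕ, ∀ s ∈ Icc 0 t, s ≤ n → |α s - s| ≤ η * n := by
    intro n
    induction n with
    | zero =>
      intro s hs hsn
      obtain rfl : s = 0 := le_antisymm (by simpa using hsn) hs.1
      simp [hα0]
    | succ n ih =>
      intro s hs hsn
      push_cast at hsn ⊢
      rcases le_or_gt s n with hle | hlt
      · linarith [ih s hs hle]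
      · have hn : (n : ℝ) ∈ Icc 0 t := ⟨n.cast_nonneg, hlt.le.trans hs.2⟩
        have hmaps : MapsTo (fun u : ℝ => n + u) (Icc 0 (s - n)) (Icc 0 t) := fun u hu =>
          ⟨add_nonneg hn.1 hu.1, by linarith [hu.2, hs.2]⟩
        have hstep := h (φ (α n) x) (φ n y) (fun u => α (n + u) - α n) (s - n)
          (by linarith) (by linarith)
          ((hα.comp (by fun_prop) hmaps).sub continuousOn_const) (by simp)
          (fun u hu => by
            rw [← hφ.map_add, ← hφ.map_add, sub_add_cancel, add_comm u]
            exact hclose _ (hmaps hu))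
        rw [add_sub_cancel] at hstep
        have hih := ih n hn le_rfl
        rw [abs_lt] at hstep
        rw [abs_le] at hih ⊢
        constructor <;> linarith [hstep.1, hstep.2, hih.1, hih.2]
  intro s hs
  refine (key ⌈s⌉₊ s hs (Nat.le_ceil s)).trans ?_
  have := (Nat.ceil_lt_add_one hs.1).le
  gcongr

/-- Two increasing reparametrizations can be composed as `α⁻¹ ∘ β`. -/
theorem exists_isReparOn_comp_eq {α β : ℝ → ℝ} {t t' : ℝ} (ht : 0 ≤ t) (ht' : 0 ≤ t')
    (hα : IsReparOn α (Icc 0 t)) (hβ : IsReparOn β (Icc 0 t'))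
    (hmaps : MapsTo β (Icc 0 t') (Icc 0 (α t))) :
    ∃ γ : ℝ → ℝ, IsReparOn γ (Icc 0 t') ∧ MapsTo γ (Icc 0 t') (Icc 0 t) ∧
      EqOn (α ∘ γ) β (Icc 0 t') := by
  obtain ⟨hαc, hαi, hα0⟩ := hα
  obtain ⟨hβc, hβi, hβ0⟩ := hβ
  have hsurj : Icc 0 (α t) ⊆ α '' Icc 0 t := by
    simpa [hα0] using intermediate_value_Icc ht hαc
  have hmem : MapsTo β (Icc 0 t') (α '' Icc 0 t) := fun u hu => hsurj (hmaps hu)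
  set g := Function.invFunOn α (Icc 0 t) with hg
  have hright : ∀ v ∈ α '' Icc 0 t, α (g v) = v := fun v hv => Function.invFunOn_eq hv
  have hgmem : ∀ v ∈ α '' Icc 0 t, g v ∈ Icc 0 t := fun v hv => Function.invFunOn_mem hv
  have hgc : ContinuousOn g (α '' Icc 0 t) := by
    rw [continuousOn_iff_isClosed]
    intro C hC
    refine ⟨α '' (C ∩ Icc 0 t), ?_, ?_⟩
    · exact ((isCompact_Icc.inter_left hC).image_of_continuousOn
        (hαc.mono inter_subset_right)).isClosed
    · ext v
      constructor
      · rintro ⟨hv, hv'⟩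
        exact ⟨⟨g v, ⟨hv, hgmem v hv'⟩, hright v hv'⟩, hv'⟩
      · rintro ⟨⟨u, hu, rfl⟩, hv'⟩
        refine ⟨?_, hv'⟩
        rw [mem_preimage, hαi (hgmem _ hv') hu.2 (hright _ hv')]
        exact hu.1
  refine ⟨g ∘ β, ⟨hgc.comp hβc hmem, fun u hu v hv huv => ?_, ?_⟩,
    fun u hu => hgmem _ (hmem hu), fun u hu => hright _ (hmem hu)⟩
  · apply hβi hu hv
    rw [← hright _ (hmem hu), ← hright _ (hmem hv)]
    exact congrArg α huv
  · have h0 : β 0 ∈ α '' Icc 0 t := hmem ⟨le_rfl, ht'⟩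
    exact hαi (hgmem _ h0) ⟨le_rfl, ht⟩ (by rw [hright _ h0, hβ0, hα0])

theorem reparBall_mono [PseudoMetricSpace X] (φ : ℝ → X → X) (x : X) (t : ℝ) {ε ε' : ℝ}
    (h : ε ≤ ε') : reparBall φ x t ε ⊆ reparBall φ x t ε' :=
  fun _ ⟨α, hα, hclose⟩ => ⟨α, hα, fun s hs => (hclose s hs).trans_le h⟩

/-- For a fixed point free flow, a small reparametrization ball is contained in a larger, slightly
shorter one centred at any of its points. -/
theorem FixedPointFree.exists_reparBall_subset [MetricSpace X] [CompactSpace X]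
    {φ : ℝ → X → X} (hφ : IsFlow φ) (hfp : FixedPointFree φ) {δ ε : ℝ}
    (hδ : 0 < δ) (hδ1 : δ ≤ 1) (hε : 0 < ε) :
    ∃ ε' > 0, ∀ (x y : X) (t : ℝ), 1 ≤ t → y ∈ reparBall φ x t ε' →
      reparBall φ x t ε' ⊆ reparBall φ y ((1 - δ) * t) ε := by
  obtain ⟨ε₁, hε₁, hdrift⟩ := hfp.exists_drift_le hφ (show 0 < δ / 4 by linarith)
  refine ⟨min ε₁ (ε / 2), lt_min hε₁ (by linarith), ?_⟩
  rintro x y t ht ⟨α, hα, hαy⟩ z ⟨β, hβ, hβz⟩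
  have ht0 : 0 ≤ t := by linarith
  have hDα := hdrift x y α t hα.1 hα.2.2 fun s hs => (hαy s hs).trans_le (min_le_left _ _)
  have hDβ := hdrift x z β t hβ.1 hβ.2.2 fun s hs => (hβz s hs).trans_le (min_le_left _ _)
  have ht'0 : 0 ≤ (1 - δ) * t := mul_nonneg (by linarith) ht0
  have ht't : (1 - δ) * t ≤ t := by nlinarith
  have hsub : Icc 0 ((1 - δ) * t) ⊆ Icc 0 t := Icc_subset_Icc_right ht't
  have hβmono : MonotoneOn β (Icc 0 t) := by
    refine (hβ.1.strictMonoOn_of_injOn_Icc ht0 ?_ hβ.2.1).monotoneOn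
    have := (abs_le.1 (hDβ t ⟨ht0, le_rfl⟩)).1
    rw [hβ.2.2]
    nlinarith
  have hmaps : MapsTo β (Icc 0 ((1 - δ) * t)) (Icc 0 (α t)) := by
    intro u hu
    refine ⟨hβ.2.2 ▸ hβmono ⟨le_rfl, ht0⟩ (hsub hu) hu.1, ?_⟩
    have h1 := (abs_le.1 (hDα t ⟨ht0, le_rfl⟩)).1
    have h2 := (abs_le.1 (hDβ u (hsub hu))).2
    have h3 : δ / 4 * (u + 1) ≤ δ / 4 * (t + 1) := by
      have := (hsub hu).2
      gcongr
    have h4 := hu.2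
    nlinarith
  obtain ⟨γ, hγ, hγmem, hγeq⟩ := exists_isReparOn_comp_eq ht0 ht'0 hα
    ⟨hβ.1.mono hsub, hβ.2.1.mono hsub, hβ.2.2⟩ hmaps
  refine ⟨γ, hγ, fun u hu => ?_⟩
  have h1 := (hαy (γ u) (hγmem hu)).trans_le (min_le_right _ _)
  have h2 := (hβz u (hsub hu)).trans_le (min_le_right _ _)
  rw [show α (γ u) = β u from hγeq hu] at h1
  have := dist_triangle_left (φ (γ u) y) (φ u z) (φ (β u) x)
  linarith

theorem le_ofReal_exp_of_lt_negLogNN_div {a : ℝ≥0∞} (ha : a ≠ ⊤) {q t : ℝ} (hq : 0 ≤ q)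
    (ht : 0 < t) (h : ENNReal.ofReal q < negLogNN a / ENNReal.ofReal t) :
    a ≤ ENNReal.ofReal (Real.exp (-q * t)) := by
  rcases eq_or_ne a 0 with rfl | h0
  · exact zero_le
  · rw [negLogNN, if_neg h0, ← ENNReal.ofReal_div_of_pos ht,
      ENNReal.ofReal_lt_ofReal_iff_of_nonneg hq, lt_div_iff₀ ht] at h
    rw [ENNReal.le_ofReal_iff_toReal_le ha (Real.exp_pos _).le,
      ← Real.log_le_iff_le_exp (ENNReal.toReal_pos h0 ha)]
    linarith

/-- A point of large lower local entropy has reparametrization balls of exponentially small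
measure. -/
theorem exists_nat_measure_reparBall_le [PseudoMetricSpace X] [MeasurableSpace X]
    {μ : Measure X} [IsFiniteMeasure μ] {φ : ℝ → X → X} {x : X} {q : ℝ} (hq : 0 ≤ q)
    (h : ENNReal.ofReal q < lowerLocalEnt μ φ x) :
    ∃ k : ℕ, ∀ t : ℝ, k ≤ t →
      μ (reparBall φ x t (1 / (k + 1))) ≤ ENNReal.ofReal (Real.exp (-q * t)) := by
  obtain ⟨ε, hlt⟩ := lt_iSup_iff.1 h
  obtain ⟨hε, hlt⟩ := lt_iSup_iff.1 hlt
  obtain ⟨T, hT⟩ := eventually_atTop.1 (eventually_lt_of_lt_liminf hlt)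
  obtain ⟨m, hm⟩ := exists_nat_one_div_lt hε
  obtain ⟨n, hn⟩ := exists_nat_ge (max T 1)
  refine ⟨max m n, fun t ht => ?_⟩
  rw [Nat.cast_max] at ht
  have hTt : max T 1 ≤ t := hn.trans ((le_max_right _ _).trans ht)
  refine (measure_mono (reparBall_mono φ x t (le_trans ?_ hm.le))).trans
    (le_ofReal_exp_of_lt_negLogNN_div (measure_ne_top μ _) hq
      (zero_lt_one.trans_le ((le_max_right _ _).trans hTt)) (hT t ((le_max_left _ _).trans hTt)))
  gcongr
  exact le_max_left m n

/-- **Billingsley-type theorem, lower bound.** If the lower local entropy of `μ` is at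
least `s` at every point of a Borel set `E` of positive measure, then
`h_top^B(φ, E) ≥ s`. -/
theorem le_bowenEntropy_of_le_lowerLocalEnt {X : Type*} [MetricSpace X] [CompactSpace X]
    [MeasurableSpace X] [BorelSpace X] (φ : ℝ → X → X) (hφ : IsFlow φ)
    (hfp : FixedPointFree φ) (μ : Measure X) [IsProbabilityMeasure μ]
    (herg : FlowErgodic φ μ) (E : Set X) (hE : MeasurableSet E) (s : ℝ) (hs : 0 < s)
    (h : ∀ x ∈ E, ENNReal.ofReal s ≤ lowerLocalEnt μ φ x) (hpos : 0 < μ E) :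
    ENNReal.ofReal s ≤ bowenEntropy φ E := by
  refine le_iInf fun r => le_iInf fun hr => le_iInf fun hM => ?_
  by_contra! hlt
  have hrs : r < s := (ENNReal.ofReal_lt_ofReal_iff hs).1 hlt
  obtain ⟨q, hrq, hqs⟩ := exists_between hrs
  have hq : 0 < q := hr.trans_lt hrq
  let A : ℕ → Set X := fun k => {x | x ∈ E ∧ ∀ t : ℝ, k ≤ t →
    μ (reparBall φ x t (1 / (k + 1))) ≤ ENNReal.ofReal (Real.exp (-q * t))}
  obtain ⟨k, hk⟩ : ∃ k, 0 < μ (A k) := by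
    by_contra! hA
    have hEA : E ⊆ ⋃ k, A k := fun x hx => by
      obtain ⟨k, hk⟩ := exists_nat_measure_reparBall_le hq.le
        (((ENNReal.ofReal_lt_ofReal_iff hs).2 hqs).trans_le (h x hx))
      exact mem_iUnion.2 ⟨k, hx, hk⟩
    exact hpos.ne' (measure_mono_null hEA (measure_iUnion_null fun k => le_zero_iff.1 (hA k)))
  obtain ⟨δ, hδ, hδ2, hδq⟩ : ∃ δ > 0, δ ≤ 1 / 2 ∧ r ≤ q * (1 - δ) := by
    refine ⟨(q - r) / (2 * q), div_pos (by linarith) (by linarith), ?_, ?_⟩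
    · rw [div_le_iff₀ (by linarith)]
      linarith
    · have : q * (1 - (q - r) / (2 * q)) = (q + r) / 2 := by
        field_simp
        ring
      linarith
  obtain ⟨ε, hε, hsub⟩ := hfp.exists_reparBall_subset hφ hδ (by linarith)
    (show (0 : ℝ) < 1 / (k + 1) by positivity)
  have hcov : coverM φ E r (2 * k + 1) ε < μ (A k) := by
    refine lt_of_le_of_lt ?_ hk
    rw [← hM]
    exact (le_iSup (fun N => coverM φ E r N ε) (2 * k + 1)).trans
      (le_iSup₂ (f := fun (ε : ℝ) (_ : 0 < ε) => coverMeps φ E r ε) ε hε)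
  simp only [coverM, iInf_lt_iff] at hcov
  obtain ⟨F, hF, hFN, hFE, hsum⟩ := hcov
  have := hF.to_subtype
  refine hsum.not_ge ?_
  calc μ (A k) ≤ μ (⋃ p : F, reparBall φ p.1.1 p.1.2 ε ∩ A k) := by
        refine measure_mono fun x hx => ?_
        obtain ⟨p, hp, hxp⟩ := mem_iUnion₂.1 (hFE hx.1)
        exact mem_iUnion.2 ⟨⟨p, hp⟩, hxp, hx⟩
    _ ≤ ∑' p : F, μ (reparBall φ p.1.1 p.1.2 ε ∩ A k) := measure_iUnion_le _
    _ ≤ ∑' p : F, ENNReal.ofReal (Real.exp (-r * p.1.2)) := by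
        refine ENNReal.tsum_le_tsum fun p => ?_
        rcases (reparBall φ p.1.1 p.1.2 ε ∩ A k).eq_empty_or_nonempty with he | ⟨y, hyp, hyA⟩
        · simp [he]
        have hN := hFN p p.2
        push_cast at hN
        have hk0 : (0 : ℝ) ≤ k := k.cast_nonneg
        have ht0 : 0 ≤ p.1.2 := by linarith
        refine (measure_mono (inter_subset_left.trans
          (hsub p.1.1 y p.1.2 (by linarith) hyp))).trans
          ((hyA.2 ((1 - δ) * p.1.2) (by nlinarith)).trans ?_)
        refine ENNReal.ofReal_le_ofReal (Real.exp_le_exp.2 ?_)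
        have := mul_le_mul_of_nonneg_right hδq ht0
        linarith

end FlowEntropy
end
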